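/- arXiv:1606.01921 — 2 statements merged into one kernel-verified Lean document; each statement's English description precedes it below -/
import Mathlib

section
/- The Tate module T_p(Ω¹_{O_K̄/O_K}) is a free O_{C_K}-module of rank 1. -/
/-- The Tate module `T_p(M) = lim_r M[p^r]` of a module `M` over a commutative ring
`R`, realized as the `R`-submodule of `ℕ → M` consisting of sequences `(x_r)` with
`p • x_{r+1} = x_r` and `p^r • x_r = 0`. -/
def TateModule (p : ℕ) (R : Type*) [CommRing R] (M : Type*) [AddCommGroup M]
    [Module R M] : Submodule R (ℕ → M) where
  carrier := {f | (∀ r, p • f (r + 1) = f r) ∧ ∀ r, p ^ r • f r = 0}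
  add_mem' := by
    intro f g hf hg
    refine ⟨fun r => ?_, fun r => ?_⟩
    · simp only [Pi.add_apply, smul_add, hf.1 r, hg.1 r]
    · simp only [Pi.add_apply, smul_add, hf.2 r, hg.2 r, add_zero]
  zero_mem' := by
    refine ⟨fun r => ?_, fun r => ?_⟩ <;> simp
  smul_mem' := by
    intro c f hf
    refine ⟨fun r => ?_, fun r => ?_⟩
    · simp only [Pi.smul_apply]
      rw [smul_comm, hf.1 r]
    · simp only [Pi.smul_apply]
      rw [smul_comm, hf.2 r, smul_zero]

section ValuationRing

variable {V M : Type*} [CommRing V] [IsDomain V] [ValuationRing V] [AddCommGroup M] [Module V M]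

/-- A multiple of an element with principal nonzero annihilator has principal annihilator. -/
theorem exists_annihilator_smul_eq_span_singleton {ω : M} {c : V} (hc : c ≠ 0)
    (hω : ∀ a : V, a • ω = 0 ↔ c ∣ a) (b : V) :
    ∃ e : V, e ≠ 0 ∧ ∀ a : V, a • b • ω = 0 ↔ e ∣ a := by
  rcases ValuationRing.dvd_total c b with h | ⟨e, rfl⟩
  · exact ⟨1, one_ne_zero, fun a => by simp [(hω b).2 h]⟩
  · refine ⟨e, right_ne_zero_of_mul hc, fun a => ?_⟩
    rw [smul_smul, hω, mul_comm a b, mul_dvd_mul_iff_left (left_ne_zero_of_mul hc)]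

/-- If any two elements of a nonzero `ϖ`-divisible module over a valuation ring are multiples of an
element with principal nonzero annihilator, then the `ϖ`-torsion is free of rank one
over `V ⧸ ϖ`. -/
theorem exists_generator_torsion_of_divisible [Nontrivial M] {ϖ : V} (hϖ0 : ϖ ≠ 0)
    (hϖ : ¬ IsUnit ϖ) (hdiv : ∀ x : M, ∃ y : M, ϖ • y = x)
    (H : ∀ x y : M, ∃ (ω : M) (c : V), c ≠ 0 ∧ (∀ a : V, a • ω = 0 ↔ c ∣ a) ∧
      (∃ b : V, b • ω = x) ∧ ∃ b : V, b • ω = y) :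
    ∃ ω : M, (∀ a : V, a • ω = 0 ↔ ϖ ∣ a) ∧ ∀ x : M, ϖ • x = 0 → ∃ b : V, b • ω = x := by
  have hann : ∀ x : M, ∃ e : V, e ≠ 0 ∧ ∀ a : V, a • x = 0 ↔ e ∣ a := by
    intro x
    obtain ⟨ω, c, hc, hω, ⟨b, rfl⟩, -⟩ := H x x
    exact exists_annihilator_smul_eq_span_singleton hc hω b
  obtain ⟨ω₀, h₀⟩ := exists_ne (0 : M)
  obtain ⟨ω₁, rfl⟩ := hdiv ω₀
  obtain ⟨c, hc, hω₁⟩ := hann ω₁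
  obtain ⟨e, rfl⟩ : ϖ ∣ c :=
    (ValuationRing.dvd_total ϖ c).resolve_right fun h => h₀ ((hω₁ ϖ).2 h)
  have he : e ≠ 0 := right_ne_zero_of_mul hc
  have hω : ∀ a : V, a • e • ω₁ = 0 ↔ ϖ ∣ a := fun a => by
    rw [smul_smul, hω₁, mul_dvd_mul_iff_right he]
  refine ⟨e • ω₁, hω, fun x hx => ?_⟩
  generalize e • ω₁ = ω at hω
  obtain ⟨τ, -, -, -, ⟨b₁, rfl⟩, ⟨b₂, rfl⟩⟩ := H ω x
  rcases ValuationRing.dvd_total b₁ b₂ with ⟨u, rfl⟩ | ⟨u, rfl⟩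
  · exact ⟨u, by rw [smul_smul, mul_comm]⟩
  · obtain ⟨c', -, hc'⟩ := hann (b₂ • τ)
    have hω' : ∀ a : V, a • (b₂ * u) • τ = 0 ↔ c' ∣ a * u := fun a => by
      rw [← hc', smul_smul, smul_smul, mul_assoc, mul_comm b₂ u]
    have h1 : c' ∣ ϖ := (hc' ϖ).1 hx
    have h2 : u ∣ c' := (ValuationRing.dvd_total u c').resolve_right fun h =>
      hϖ (isUnit_of_dvd_one ((hω 1).1 ((hω' 1).2 (by simpa using h))))
    obtain ⟨v, rfl⟩ := h2
    have h3 : ϖ ∣ v := (hω v).1 ((hω' v).2 (by rw [mul_comm]))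
    have hu : IsUnit u := by
      obtain ⟨w, rfl⟩ := h3
      obtain ⟨z, hz⟩ := h1
      refine .of_mul_eq_one (w * z) (mul_left_cancel₀ hϖ0 ?_)
      linear_combination -hz
    obtain ⟨u, rfl⟩ := hu
    refine ⟨((u⁻¹ : Vˣ) : V), ?_⟩
    rw [smul_smul]
    congr 1
    rw [mul_comm, mul_assoc, Units.mul_inv, mul_one]

end ValuationRing

section TateModule

variable {p : ℕ} {V M : Type*} [CommRing V] [AddCommGroup M] [Module V M]

namespace TateModule

theorem eq_zero_of_natCast_smul_eq_zero {x : TateModule p V M} (h : p • x = 0) : x = 0 := by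
  ext r
  have := congr_fun (congr_arg Subtype.val h) (r + 1)
  rw [← x.2.1 r]
  exact this

theorem exists_smul_eq_of_apply_one_eq_zero {x : TateModule p V M} (h : x.1 1 = 0) :
    ∃ y : TateModule p V M, p • y = x := by
  have key : ∀ r, p ^ r • x.1 (r + 1) = x.1 1 := by
    intro r
    induction r with
    | zero => simp
    | succ r ih => rw [pow_succ, mul_smul, x.2.1, ih]
  refine ⟨⟨fun r => x.1 (r + 1), fun r => x.2.1 (r + 1), fun r => by rw [key, h]⟩, ?_⟩
  ext r
  exact x.2.1 r

theorem apply_eq_zero_of_pow_smul {x : TateModule p V M} {n r : ℕ} (hr : r ≤ n) :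
    (p ^ n • x).1 r = 0 := by
  obtain ⟨k, rfl⟩ := Nat.exists_eq_add_of_le hr
  have : p ^ (r + k) • x.1 r = 0 := by rw [add_comm, pow_add, mul_smul, x.2.2 r, smul_zero]
  exact this

theorem exists_apply_one_eq (hdiv : ∀ x : M, ∃ y : M, p • y = x) {x : M} (hx : p • x = 0) :
    ∃ t : TateModule p V M, t.1 1 = x := by
  choose g hg using hdiv
  let f : ℕ → M := fun r => Nat.casesOn r 0 fun k => g^[k] x
  have hf : ∀ r, p • f (r + 1) = f r := by
    rintro (_ | r)
    · exact hx
    · change p • (g^[r + 1] x) = g^[r] x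
      rw [Function.iterate_succ_apply', hg]
  refine ⟨⟨f, hf, fun r => ?_⟩, rfl⟩
  induction r with
  | zero => simp [f]
  | succ r ih => rw [pow_succ, mul_smul, hf, ih]

/-- If the `p`-torsion of a `p`-divisible module `M` is free of rank one over `V ⧸ p`, then the Tate
module of `M` is free of rank one over the `p`-adic completion of `V`. -/
theorem exists_existsUnique_smul_eq (hdiv : ∀ x : M, ∃ y : M, p • y = x)
    {ω : M} (hω : ∀ a : V, a • ω = 0 ↔ (p : V) ∣ a)
    (hgen : ∀ x : M, p • x = 0 → ∃ b : V, b • ω = x)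
    {W : Type*} [CommRing W] (ρ : V →+* W)
    (hdense : ∀ x : W, ∃ y : V, x - ρ y ∈ Ideal.span {(p : W)})
    [IsAdicComplete (Ideal.span {(p : W)}) W]
    [Module W (TateModule p V M)]
    (hcompat : ∀ (a : V) (x : TateModule p V M), ρ a • x = a • x) :
    ∃ t : TateModule p V M, ∀ x : TateModule p V M, ∃! a : W, a • t = x := by
  obtain ⟨t, ht⟩ := exists_apply_one_eq (V := V) hdiv (x := ω)
    (by rw [← Nat.cast_smul_eq_nsmul V, hω])
  have hspan : ∀ n : ℕ, (Ideal.span {(p : W)}) ^ n • (⊤ : Ideal W) = Ideal.span {(p : W) ^ n} := by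
    intro n
    rw [Ideal.span_singleton_pow, smul_eq_mul, Ideal.mul_top]
  have step : ∀ x : TateModule p V M, ∃ (a : V) (y : TateModule p V M), x = a • t + p • y := by
    intro x
    have hx : p • x.1 1 = 0 := by simpa using x.2.2 1
    obtain ⟨a, ha⟩ := hgen _ hx
    obtain ⟨y, hy⟩ := exists_smul_eq_of_apply_one_eq_zero (x := x - a • t) (by
      change x.1 1 - a • t.1 1 = 0
      rw [ht, ha, sub_self])
    exact ⟨a, y, by rw [hy]; abel⟩
  have hinj : ∀ c : W, c • t = 0 → c = 0 := by
    intro c hc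
    have hdvd : ∀ c : W, c • t = 0 → ∃ c' : W, c = p * c' ∧ c' • t = 0 := by
      intro c hc
      obtain ⟨y, hy⟩ := hdense c
      obtain ⟨z, hz⟩ := Ideal.mem_span_singleton.1 hy
      have hc2 : c = ρ y + p * z := by rw [← hz]; ring
      have hy0 : y • ω = 0 := by
        have h1 : y • t + p • (z • t) = 0 := by
          rw [← hc, hc2, add_smul, hcompat, mul_smul, Nat.cast_smul_eq_nsmul]
        have h2 : y • t.1 1 + (p • (z • t)).1 1 = 0 := congr_fun (congr_arg Subtype.val h1) 1
        have h3 := apply_eq_zero_of_pow_smul (x := z • t) (le_refl 1)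
        rw [pow_one] at h3
        rwa [h3, add_zero, ht] at h2
      obtain ⟨y', rfl⟩ := (hω y).1 hy0
      refine ⟨ρ y' + z, by rw [hc2, map_mul, map_natCast]; ring,
        eq_zero_of_natCast_smul_eq_zero ?_⟩
      rw [← Nat.cast_smul_eq_nsmul W, ← mul_smul, ← hc, hc2, map_mul, map_natCast, mul_add]
    have hpow : ∀ (n : ℕ), ∃ c' : W, c = (p : W) ^ n * c' ∧ c' • t = 0 := by
      intro n
      induction n with
      | zero => exact ⟨c, by simp, hc⟩
      | succ n ih =>
        obtain ⟨c', rfl, h⟩ := ih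
        obtain ⟨c'', rfl, h'⟩ := hdvd c' h
        exact ⟨c'', by ring, h'⟩
    refine IsHausdorff.haus (inferInstance : IsHausdorff (Ideal.span {(p : W)}) W) c fun n => ?_
    obtain ⟨c', rfl, -⟩ := hpow n
    rw [SModEq.zero, hspan]
    exact Ideal.mul_mem_right _ _ (Ideal.mem_span_singleton_self _)
  refine ⟨t, fun x => ?_⟩
  choose a g hag using step
  let b : ℕ → W := fun n => ∑ i ∈ Finset.range n, (p : W) ^ i * ρ (a (g^[i] x))
  have hb : ∀ n, x = b n • t + p ^ n • g^[n] x := by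
    intro n
    induction n with
    | zero => simp [b]
    | succ n ih =>
      have h1 : b (n + 1) = b n + (p : W) ^ n * ρ (a (g^[n] x)) := Finset.sum_range_succ _ _
      rw [h1, add_smul, mul_smul, hcompat, add_assoc, ← Nat.cast_pow,
        Nat.cast_smul_eq_nsmul, pow_succ, mul_smul, Function.iterate_succ_apply', ← smul_add, ← hag]
      exact ih
  obtain ⟨L, hL⟩ := IsPrecomplete.prec
    (inferInstance : IsPrecomplete (Ideal.span {(p : W)}) W) (f := b) (by
      intro m n hmn
      rw [hspan, SModEq.sub_mem, ← neg_mem_iff, neg_sub, ← Finset.sum_sdiff_eq_sub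
        (Finset.range_mono hmn)]
      refine Ideal.sum_mem _ fun i hi => Ideal.mem_span_singleton.2 (Dvd.dvd.mul_right
        (pow_dvd_pow _ ?_) _)
      simp only [Finset.mem_sdiff, Finset.mem_range, not_lt] at hi
      exact hi.2)
  have hLx : L • t = x := by
    ext r
    have h1 := hL r
    rw [hspan, SModEq.sub_mem, Ideal.mem_span_singleton] at h1
    obtain ⟨z, hz⟩ := h1
    have h2 : L • t - x = p ^ r • (-(z • t) - g^[r] x) := by
      have h3 : L = b r - (p : W) ^ r * z := by rw [← hz]; ring
      conv_lhs => rw [hb r, h3]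
      rw [sub_smul, mul_smul, ← Nat.cast_pow, Nat.cast_smul_eq_nsmul, smul_sub, smul_neg]
      abel
    have h4 := apply_eq_zero_of_pow_smul (x := -(z • t) - g^[r] x) (le_refl r)
    rw [← h2] at h4
    exact sub_eq_zero.1 h4
  exact ⟨L, hLx, fun c hc => sub_eq_zero.1 (hinj _ (by rw [sub_smul, hLx, hc, sub_self]))⟩

end TateModule

end TateModule

section Monogenic

open Polynomial IsLocalRing

/-- If `g (y)` generates the maximal ideal of a discrete valuation ring `B` finite over the local
ring `A` and `y` generates the residue field of `B`, then `y` generates `B`. -/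
theorem IsLocalRing.adjoin_eq_top_of_irreducible_aeval {A B : Type*} [CommRing A]
    [CommRing B] [Algebra A B] [IsLocalRing A] [IsDomain B] [IsDiscreteValuationRing B]
    [Module.Finite A B] (hA : (maximalIdeal A).map (algebraMap A B) ≠ ⊥) {y : B} {g : A[X]}
    (hg : Irreducible (aeval y g)) (hy : ∀ z : B, ∃ q : A[X], z - aeval y q ∈ maximalIdeal B) :
    Algebra.adjoin A {y} = ⊤ := by
  have hmax := (IsDiscreteValuationRing.irreducible_iff_uniformizer _).1 hg
  have key : ∀ (j : ℕ) (z : B), ∃ q : A[X], z - aeval y q ∈ maximalIdeal B ^ j := by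
    intro j
    induction j with
    | zero => exact fun z => ⟨0, by simp⟩
    | succ j ih =>
      intro z
      obtain ⟨q, hq⟩ := ih z
      rw [hmax, Ideal.span_singleton_pow, Ideal.mem_span_singleton] at hq
      obtain ⟨u, hu⟩ := hq
      obtain ⟨q', hq'⟩ := hy u
      refine ⟨q + g ^ j * q', ?_⟩
      have : z - aeval y (q + g ^ j * q') = (aeval y g) ^ j * (u - aeval y q') := by
        rw [map_add, map_mul, map_pow]
        linear_combination hu
      rw [this, pow_succ]
      exact Ideal.mul_mem_mul (Ideal.pow_mem_pow (hmax ▸ Ideal.mem_span_singleton_self _) _) hq'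
  obtain ⟨j, hj⟩ := IsDiscreteValuationRing.ideal_eq_span_pow_irreducible hA hg
  rw [← Ideal.span_singleton_pow, ← hmax] at hj
  suffices h : (⊤ : Submodule A B) ≤ Subalgebra.toSubmodule (Algebra.adjoin A {y}) by
    exact eq_top_iff.2 h
  refine Submodule.le_of_le_smul_of_le_jacobson_bot
    (Module.finite_def.mp inferInstance) (maximalIdeal_le_jacobson ⊥)
    (?_ : ⊤ ≤ Subalgebra.toSubmodule (Algebra.adjoin A {y}) ⊔ maximalIdeal A • ⊤)
  intro s _
  obtain ⟨q, hq⟩ := key j s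
  rw [Ideal.smul_top_eq_map]
  refine Submodule.mem_sup.mpr ⟨aeval y q, ?_, s - aeval y q, ?_, by ring⟩
  · rw [Algebra.adjoin_singleton_eq_range_aeval]; exact ⟨q, rfl⟩
  · rwa [Submodule.restrictScalars_mem, hj]

/-- A finite extension of discrete valuation rings with separable residue extension is generated by
a single element. -/
theorem IsLocalRing.exists_adjoin_eq_top_of_isDiscreteValuationRing {A B : Type*} [CommRing A]
    [CommRing B] [Algebra A B] [IsLocalRing A] [IsDomain B] [IsDiscreteValuationRing B]
    [Module.Finite A B] [IsLocalHom (algebraMap A B)]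
    [Algebra.IsSeparable (ResidueField A) (ResidueField B)]
    (hA : (maximalIdeal A).map (algebraMap A B) ≠ ⊥) :
    ∃ y : B, Algebra.adjoin A {y} = ⊤ := by
  obtain ⟨β₀, hβ₀⟩ := Field.exists_primitive_element (ResidueField A) (ResidueField B)
  obtain ⟨π, hπ⟩ := IsDiscreteValuationRing.exists_irreducible B
  have hmax := (IsDiscreteValuationRing.irreducible_iff_uniformizer _).1 hπ
  obtain ⟨g, hg⟩ := Polynomial.map_surjective _ residue_surjective (minpoly (ResidueField A) β₀)
  have hcomp : ∀ (y : B) (q : A[X]), residue B (aeval y q) = aeval (residue B y)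
      (q.map (residue A)) := fun y q =>
    map_aeval_eq_aeval_map (ψ := residue B) (φ := residue A) rfl q y
  have hgen : ∀ y : B, residue B y = β₀ →
      ∀ z : B, ∃ q : A[X], z - aeval y q ∈ maximalIdeal B := by
    intro y hy z
    have h : residue B z ∈ Algebra.adjoin (ResidueField A) {β₀} := by
      rw [← IntermediateField.adjoin_simple_toSubalgebra_of_isAlgebraic (IsAlgebraic.of_finite _ _),
        hβ₀]
      trivial
    rw [Algebra.adjoin_singleton_eq_range_aeval] at h
    obtain ⟨p, hp⟩ := h
    obtain ⟨q, rfl⟩ := Polynomial.map_surjective _ residue_surjective p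
    refine ⟨q, ?_⟩
    rw [← residue_eq_zero_iff, map_sub, hcomp, hy, sub_eq_zero]
    exact hp.symm
  have hirr : ∀ y : B, residue B y = β₀ → ¬ π ^ 2 ∣ aeval y g → Irreducible (aeval y g) := by
    intro y hy h
    have h1 : aeval y g ∈ maximalIdeal B := by
      rw [← residue_eq_zero_iff, hcomp, hy, hg, minpoly.aeval]
    rw [hmax, Ideal.mem_span_singleton] at h1
    obtain ⟨u, hu⟩ := h1
    have : IsUnit u := by
      by_contra hu'
      have : u ∈ maximalIdeal B := hu'
      rw [hmax, Ideal.mem_span_singleton] at this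
      obtain ⟨v, rfl⟩ := this
      exact h ⟨v, by rw [hu]; ring⟩
    rw [hu]
    exact (irreducible_mul_isUnit this).2 hπ
  obtain ⟨y, hy⟩ := residue_surjective (R := B) β₀
  by_cases h : π ^ 2 ∣ aeval y g
  · have hyπ : residue B (y + π) = β₀ := by
      rw [map_add, hy, (residue_eq_zero_iff π).2 (hmax ▸ Ideal.mem_span_singleton_self _), add_zero]
    refine ⟨y + π, adjoin_eq_top_of_irreducible_aeval hA (hirr _ hyπ fun h' => ?_) (hgen _ hyπ)⟩
    obtain ⟨k, hk⟩ := exists_mul_sq_add_linear_part_eq_eval_add (g.map (algebraMap A B)) y π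
    rw [derivative_map, eval_map_algebraMap, eval_map_algebraMap, eval_map_algebraMap] at hk
    have hunit : residue B (aeval y (derivative g)) ≠ 0 := by
      rw [hcomp, hy, ← derivative_map, hg]
      exact (Algebra.IsSeparable.isSeparable (ResidueField A) β₀).aeval_derivative_ne_zero
        (minpoly.aeval _ _)
    refine hunit ((residue_eq_zero_iff _).2 ?_)
    rw [hmax, Ideal.mem_span_singleton, ← mul_dvd_mul_iff_right hπ.ne_zero, ← pow_two]
    have : aeval y (derivative g) * π = aeval (y + π) g - k * π ^ 2 - aeval y g := by
      rw [← hk]; ring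
    rw [this]
    exact ((h'.sub (Dvd.intro_left k rfl)).sub h)
  · exact ⟨y, adjoin_eq_top_of_irreducible_aeval hA (hirr y hy h) (hgen y hy)⟩

end Monogenic

section PadicIntegers

open IsLocalRing

variable {p : ℕ} [Fact p.Prime] {F : Type*} [Field F] [Algebra ℚ_[p] F] [Algebra ℤ_[p] F]
  [IsScalarTower ℤ_[p] ℚ_[p] F]

theorem PadicInt.isIntegral_iff_spectralNorm_le_one [Algebra.IsAlgebraic ℚ_[p] F] {x : F} :
    IsIntegral ℤ_[p] x ↔ spectralNorm ℚ_[p] F x ≤ 1 := by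
  have hx : IsIntegral ℚ_[p] x := (Algebra.IsAlgebraic.isAlgebraic x).isIntegral
  rw [spectralNorm, spectralValue_le_one_iff (minpoly.monic hx)]
  constructor
  · intro h n
    rw [minpoly.isIntegrallyClosed_eq_field_fractions' ℚ_[p] h, Polynomial.coeff_map]
    exact PadicInt.norm_le_one _
  · intro h
    have hl : minpoly ℚ_[p] x ∈ Polynomial.lifts (algebraMap ℤ_[p] ℚ_[p]) := by
      rw [Polynomial.lifts_iff_coeff_lifts]
      exact fun n => ⟨⟨_, h n⟩, rfl⟩
    obtain ⟨q, hq, -, hqm⟩ := Polynomial.lifts_and_natDegree_eq_and_monic hl (minpoly.monic hx)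
    refine ⟨q, hqm, ?_⟩
    have := minpoly.aeval ℚ_[p] x
    rwa [← hq, Polynomial.aeval_map_algebraMap] at this

theorem PadicInt.isIntegral_or_isIntegral_inv [Algebra.IsAlgebraic ℚ_[p] F] (x : F) :
    IsIntegral ℤ_[p] x ∨ IsIntegral ℤ_[p] x⁻¹ := by
  simp only [isIntegral_iff_spectralNorm_le_one]
  by_cases hx : x = 0
  · simp [hx, spectralNorm_zero]
  · have h : spectralNorm ℚ_[p] F x * spectralNorm ℚ_[p] F x⁻¹ = 1 := by
      have h1 := spectralAlgNorm_mul (K := ℚ_[p]) (L := F) x x⁻¹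
      rw [mul_inv_cancel₀ hx] at h1
      simp only [spectralAlgNorm_def] at h1
      rw [← h1, spectralNorm_one]
    by_contra! hcon
    nlinarith [hcon.1, hcon.2]

variable {A : Type*} [CommRing A] [Algebra A F]

/-- A subring of an algebraic extension of `ℚ_p` cut out by integrality within a subfield is a
valuation ring. -/
theorem PadicInt.valuationRing_of_range [Algebra.IsAlgebraic ℚ_[p] F] [IsDomain A]
    [FaithfulSMul A F] (L : IntermediateField ℚ_[p] F)
    (h : ∀ x : F, (∃ a, algebraMap A F a = x) ↔ x ∈ L ∧ IsIntegral ℤ_[p] x) :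
    ValuationRing A := by
  have hinj := FaithfulSMul.algebraMap_injective A F
  have hmem : ∀ a : A, algebraMap A F a ∈ L := fun a => ((h _).1 ⟨a, rfl⟩).1
  refine (ValuationRing.iff_dvd_total (R := A)).2 ⟨fun a b => ?_⟩
  by_cases ha : a = 0
  · exact .inr (ha ▸ dvd_zero b)
  by_cases hb : b = 0
  · exact .inl (hb ▸ dvd_zero a)
  have ha' : algebraMap A F a ≠ 0 := fun h => ha (hinj (h.trans (map_zero _).symm))
  have hb' : algebraMap A F b ≠ 0 := fun h => hb (hinj (h.trans (map_zero _).symm))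
  rcases isIntegral_or_isIntegral_inv (p := p) (algebraMap A F a / algebraMap A F b) with hi | hi
  · obtain ⟨c, hc⟩ := (h _).2 ⟨L.div_mem (hmem a) (hmem b), hi⟩
    exact .inr ⟨c, hinj (by rw [map_mul, hc, mul_div_cancel₀ _ hb'])⟩
  · rw [inv_div] at hi
    obtain ⟨c, hc⟩ := (h _).2 ⟨L.div_mem (hmem b) (hmem a), hi⟩
    exact .inl ⟨c, hinj (by rw [map_mul, hc, mul_div_cancel₀ _ ha'])⟩

variable [Algebra ℤ_[p] A] [IsScalarTower ℤ_[p] A F]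

theorem PadicInt.faithfulSMul (p : ℕ) [Fact p.Prime] (F : Type*) [Field F] [Algebra ℚ_[p] F]
    [Algebra ℤ_[p] F] [IsScalarTower ℤ_[p] ℚ_[p] F] (A : Type*) [CommRing A] [Algebra A F]
    [Algebra ℤ_[p] A] [IsScalarTower ℤ_[p] A F] : FaithfulSMul ℤ_[p] A := by
  have : FaithfulSMul ℤ_[p] F := FaithfulSMul.trans ℤ_[p] ℚ_[p] F
  rw [faithfulSMul_iff_algebraMap_injective]
  refine Function.Injective.of_comp (f := algebraMap A F) ?_
  rw [← RingHom.coe_comp, ← IsScalarTower.algebraMap_eq]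
  exact FaithfulSMul.algebraMap_injective ℤ_[p] F

theorem PadicInt.finite_of_range [FaithfulSMul A F] (L : IntermediateField ℚ_[p] F)
    [FiniteDimensional ℚ_[p] L]
    (h : ∀ x : F, (∃ a, algebraMap A F a = x) → x ∈ L ∧ IsIntegral ℤ_[p] x) :
    Module.Finite ℤ_[p] A := by
  have hinj := FaithfulSMul.algebraMap_injective A F
  let f : A →ₐ[ℤ_[p]] L :=
    (IsScalarTower.toAlgHom ℤ_[p] A F).codRestrict (L.toSubalgebra.restrictScalars ℤ_[p])
      fun a => (h _ ⟨a, rfl⟩).1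
  have hf : Function.Injective f := fun a b hab => hinj (congr_arg Subtype.val hab)
  have hfint : ∀ a, f a ∈ integralClosure ℤ_[p] L := fun a =>
    (isIntegral_algHom_iff (L.val.restrictScalars ℤ_[p]) Subtype.val_injective).1 (h _ ⟨a, rfl⟩).2
  have := IsIntegralClosure.finite ℤ_[p] ℚ_[p] L (integralClosure ℤ_[p] L)
  exact Module.Finite.of_injective (f.codRestrict _ hfint).toLinearMap
    fun a b hab => hf (congr_arg Subtype.val hab)

theorem PadicInt.not_isUnit_natCast_of_isIntegral [Nontrivial A] [Algebra.IsIntegral ℤ_[p] A]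
    [FaithfulSMul ℤ_[p] A] : ¬ IsUnit (p : A) := by
  intro h
  rw [← map_natCast (algebraMap ℤ_[p] A), isUnit_map_iff] at h
  exact PadicInt.prime_p.not_isUnit h

theorem PadicInt.isDiscreteValuationRing_of_range [Algebra.IsAlgebraic ℚ_[p] F] [IsDomain A]
    [FaithfulSMul A F] (L : IntermediateField ℚ_[p] F) [FiniteDimensional ℚ_[p] L]
    (h : ∀ x : F, (∃ a, algebraMap A F a = x) ↔ x ∈ L ∧ IsIntegral ℤ_[p] x) :
    IsDiscreteValuationRing A := by
  have := valuationRing_of_range L h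
  have := finite_of_range L fun x => (h x).1
  have := IsNoetherianRing.of_finite ℤ_[p] A
  have := faithfulSMul p F A
  have hp : (p : A) ∈ maximalIdeal A := not_isUnit_natCast_of_isIntegral
  exact { not_a_field' := fun h0 => PadicInt.prime_p.ne_zero
            (FaithfulSMul.algebraMap_injective ℤ_[p] A (by simpa [h0] using hp)) }

/-- An extension of discrete valuation rings finite over `ℤ_p` is generated by a single element. -/
theorem PadicInt.exists_adjoin_eq_top {A B : Type*} [CommRing A] [CommRing B] [Algebra ℤ_[p] A]
    [Algebra ℤ_[p] B] [Algebra A B] [IsScalarTower ℤ_[p] A B] [IsDomain A] [IsDomain B]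
    [IsLocalRing A] [IsDiscreteValuationRing B] [Module.Finite ℤ_[p] A]
    [Module.Finite ℤ_[p] B] [FaithfulSMul ℤ_[p] B] [FaithfulSMul A B] :
    ∃ y : B, Algebra.adjoin A {y} = ⊤ := by
  have : FaithfulSMul ℤ_[p] A := by
    rw [faithfulSMul_iff_algebraMap_injective]
    refine Function.Injective.of_comp (f := algebraMap A B) ?_
    rw [← RingHom.coe_comp, ← IsScalarTower.algebraMap_eq]
    exact FaithfulSMul.algebraMap_injective ℤ_[p] B
  have : Module.Finite A B := Module.Finite.of_restrictScalars_finite ℤ_[p] A B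
  have : Finite (ResidueField ℤ_[p]) := inferInstance
  have : Finite (ResidueField A) := ResidueField.finite_of_finite (R := ℤ_[p]) this
  refine exists_adjoin_eq_top_of_isDiscreteValuationRing fun h => PadicInt.prime_p.ne_zero
    (FaithfulSMul.algebraMap_injective ℤ_[p] B ?_)
  have := Ideal.mem_map_of_mem (algebraMap A B)
    (show (p : A) ∈ maximalIdeal A from not_isUnit_natCast_of_isIntegral)
  rw [h] at this
  simpa using this

end PadicIntegers

section DerivationLift

open Polynomial

variable {V N : Type*} [CommRing V] [IsDomain V] [AddCommGroup N] [Module V N] [Module Vᵐᵒᵖ N]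
  [IsCentralScalar V N] {A : Type*} [CommRing A] [IsDomain A] [IsIntegrallyClosed A] [Algebra A V]
  [FaithfulSMul A V]

/-- A derivation on an integrally closed domain `A`, viewed as a lift of `A → V` to the trivial
square-zero extension of `V` by `N`, extends to `A[y]` with prescribed value `n` at `y`, as long
as `n` satisfies the equation obtained by differentiating the minimal polynomial of `y`. -/
theorem TrivSqZeroExt.exists_lift_adjoin_singleton {y : V} (hy : IsIntegral A y)
    (φ : A →+* TrivSqZeroExt V N) (hφ : ∀ a, (φ a).fst = algebraMap A V a) {n : N}
    (hn : aeval y (derivative (minpoly A y)) • n +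
      ((minpoly A y).eval₂ φ (inl y)).snd = 0) :
    ∃ ψ : Algebra.adjoin A {y} →+* TrivSqZeroExt V N, (∀ a, ψ (algebraMap A _ a) = φ a) ∧
      ψ ⟨y, Algebra.self_mem_adjoin_singleton A y⟩ = inl y + inr n ∧ ∀ z, (ψ z).fst = z := by
  have hcomp : (fstHom V V N : TrivSqZeroExt V N →+* V).comp φ = algebraMap A V := by
    ext a
    exact hφ a
  have hfst : ∀ (q : A[X]) (z : TrivSqZeroExt V N), (q.eval₂ φ z).fst = aeval z.fst q := by
    intro q z
    have := hom_eval₂ q φ (fstHom V V N : TrivSqZeroExt V N →+* V) z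
    rw [hcomp] at this
    exact this
  have hroot : (minpoly A y).eval₂ φ (inl y + inr n) = 0 := by
    rw [← eval_map, eval_add_of_sq_eq_zero _ _ _ (by rw [pow_two, inr_mul_inr]), derivative_map,
      eval_map, eval_map]
    ext
    · rw [fst_add, hfst, fst_inl, minpoly.aeval, fst_mul, fst_inr, mul_zero, add_zero, fst_zero]
    · rw [snd_add, snd_mul, hfst, fst_inl, fst_inr, snd_inr, MulOpposite.op_zero, zero_smul,
        add_zero, add_comm, hn, snd_zero]
  let g : AdjoinRoot (minpoly A y) →+* TrivSqZeroExt V N := AdjoinRoot.lift φ _ hroot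
  let e := minpoly.equivAdjoin hy
  have he : e.symm ⟨y, Algebra.self_mem_adjoin_singleton A y⟩ = AdjoinRoot.root _ := by
    rw [AlgEquiv.symm_apply_eq]
    exact Subtype.ext (AdjoinRoot.Minpoly.coe_toAdjoin_mk_X (R := A) (x := y)).symm
  refine ⟨g.comp e.symm.toRingEquiv.toRingHom, fun a => ?_, ?_, fun z => ?_⟩
  · change g (e.symm (algebraMap A _ a)) = _
    rw [AlgEquiv.commutes]
    exact AdjoinRoot.lift_of hroot
  · change g (e.symm _) = _
    rw [he]
    exact AdjoinRoot.lift_root hroot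
  · obtain ⟨z, rfl⟩ := e.surjective z
    obtain ⟨q, rfl⟩ := AdjoinRoot.mk_surjective z
    change (g (e.symm (e _))).fst = _
    rw [e.symm_apply_apply, AdjoinRoot.lift_mk, hfst]
    rw [fst_add, fst_inl, fst_inr, add_zero]
    exact (aeval_subalgebra_coe q _ ⟨y, Algebra.self_mem_adjoin_singleton A y⟩).symm

end DerivationLift

section LocalDerivation

open Filter

/-- A relation `a • d y = 0` in `Ω[V⁄R]` is preserved by any system of derivations, each defined
on a subalgebra of `V`, with a common value at `y`, if the subalgebras exhaust `V`. -/
theorem KaehlerDifferential.smul_eq_zero_of_forall_finset {R V N : Type*} [CommRing R] [CommRing V]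
    [Algebra R V] [AddCommGroup N] [Module V N] {y : V} {n : N}
    (H : ∀ s : Finset V, ∃ (B : Subalgebra R V) (δ : V → N), (∀ v ∈ s, v ∈ B) ∧
      (∀ a ∈ B, ∀ b ∈ B, δ (a + b) = δ a + δ b) ∧
      (∀ a ∈ B, ∀ b ∈ B, δ (a * b) = a • δ b + b • δ a) ∧
      (∀ r : R, δ (algebraMap R V r) = 0) ∧ δ y = n)
    {a : V} (ha : a • KaehlerDifferential.D R V y = 0) : a • n = 0 := by
  choose B δ hB hadd hmul hR hy using H
  have hev : ∀ v : V, ∀ᶠ s in (atTop : Filter (Finset V)), v ∈ B s := fun v => by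
    filter_upwards [eventually_ge_atTop {v}] with s hs
    exact hB s v (hs (Finset.mem_singleton_self v))
  let G := Germ (atTop : Filter (Finset V)) N
  let : Module R G := Module.compHom G (algebraMap R V)
  have : IsScalarTower R V G := IsScalarTower.of_algebraMap_smul fun _ _ => rfl
  let f : V →+ G := AddMonoidHom.mk' (fun v => ((fun s => δ s v : Finset V → N) : G)) fun v w => by
    refine Germ.coe_eq.2 ?_
    filter_upwards [hev v, hev w] with s hv hw using hadd s v hv w hw
  have hf : ∀ v w, f (v * w) = v • f w + w • f v := fun v w => by
    refine Germ.coe_eq.2 ?_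
    filter_upwards [hev v, hev w] with s hv hw using hmul s v hv w hw
  have hfR : ∀ r : R, f (algebraMap R V r) = 0 := fun r => by
    refine Germ.coe_eq.2 ?_
    filter_upwards with s using hR s r
  let D : Derivation R V G := Derivation.mk'
    { f with
      map_smul' := fun r v => by
        change f (r • v) = algebraMap R V r • f v
        rw [Algebra.smul_def, hf, hfR, smul_zero, add_zero] } hf
  have hD : D.liftKaehlerDifferential (a • KaehlerDifferential.D R V y) = a • f y := by
    rw [map_smul, Derivation.liftKaehlerDifferential_comp_D]
    rfl
  rw [ha, map_zero] at hD
  obtain ⟨s, hs⟩ := (Germ.coe_eq.1 hD).exists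
  rw [← hy s]
  exact hs.symm

end LocalDerivation

section SimpleRoot

open Polynomial IsLocalRing

/-- If `y` is a simple root modulo the maximal ideal of a polynomial over `R`, then every nonunit of
`R[y]` is divisible by a generator of the maximal ideal of `R`. -/
theorem IsLocalRing.dvd_aeval_of_isUnit_aeval_derivative {R V : Type*} [CommRing R] [CommRing V]
    [Algebra R V] [IsLocalRing R] [IsLocalRing V] [IsLocalHom (algebraMap R V)] {ϖ : R}
    (hϖ : maximalIdeal R = Ideal.span {ϖ}) {y : V} {f : R[X]} (hf : aeval y f = 0)
    (hf' : IsUnit (aeval y (derivative f))) {h : R[X]} (hh : ¬ IsUnit (aeval y h)) :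
    algebraMap R V ϖ ∣ aeval y h := by
  have hcomp : ∀ q : R[X], residue V (aeval y q) = aeval (residue V y) (q.map (residue R)) :=
    fun q => map_aeval_eq_aeval_map (ψ := residue V) (φ := residue R) rfl q y
  obtain ⟨g, hg⟩ := Polynomial.map_surjective _ residue_surjective
    (minpoly (ResidueField R) (residue V y))
  have hdiv : ∀ q : R[X], ¬ IsUnit (aeval y q) → ∃ u w : R[X], q = g * u + C ϖ * w := by
    intro q hq
    have h0 : aeval (residue V y) (q.map (residue R)) = 0 := by
      rw [← hcomp, residue_eq_zero_iff]
      exact hq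
    obtain ⟨u₀, hu₀⟩ := minpoly.dvd _ _ h0
    obtain ⟨u, rfl⟩ := Polynomial.map_surjective _ residue_surjective u₀
    have : C ϖ ∣ q - g * u := by
      rw [C_dvd_iff_dvd_coeff]
      intro i
      rw [← Ideal.mem_span_singleton, ← hϖ, ← residue_eq_zero_iff, ← coeff_map,
        Polynomial.map_sub, Polynomial.map_mul, hg, hu₀, sub_self, coeff_zero]
    obtain ⟨w, hw⟩ := this
    exact ⟨u, w, by rw [← hw]; ring⟩
  have hϖV : algebraMap R V ϖ ∈ maximalIdeal V :=
    ((local_hom_TFAE (algebraMap R V)).out 0 2 rfl rfl).1 ‹_›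
      (Ideal.mem_map_of_mem _ (hϖ ▸ Ideal.mem_span_singleton_self ϖ))
  have hgV : aeval y g ∈ maximalIdeal V := by
    rw [← residue_eq_zero_iff, hcomp, hg, minpoly.aeval]
  obtain ⟨s, w, rfl⟩ := hdiv f (by rw [hf]; exact not_isUnit_zero)
  have hs : IsUnit (aeval y s) := by
    by_contra hs
    refine (mem_maximalIdeal _).1 ?_ hf'
    have hs' : aeval y s ∈ maximalIdeal V := hs
    simp only [derivative_mul, derivative_C, map_add, map_mul, aeval_C, zero_mul, zero_add]
    exact add_mem (add_mem (Ideal.mul_mem_left _ _ hs') (Ideal.mul_mem_right _ _ hgV))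
      (Ideal.mul_mem_right _ _ hϖV)
  have hdvd : algebraMap R V ϖ ∣ aeval y g := by
    rw [← hs.dvd_mul_right]
    refine ⟨- aeval y w, ?_⟩
    simp only [map_add, map_mul, aeval_C] at hf
    linear_combination hf
  obtain ⟨u, w', rfl⟩ := hdiv h hh
  simp only [map_add, map_mul, aeval_C]
  exact dvd_add (hdvd.mul_right _) (Dvd.intro _ rfl)

end SimpleRoot

section IntegralClosure

open Polynomial

variable {p : ℕ} [Fact p.Prime] {F : Type*} [Field F] [Algebra ℚ_[p] F] [Algebra ℤ_[p] F]
  [IsScalarTower ℤ_[p] ℚ_[p] F] {V : Type*} [CommRing V] [Algebra ℤ_[p] V] [Algebra V F]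
  [IsScalarTower ℤ_[p] V F]

namespace PadicInt

variable (V) in
/-- The elements of `V` lying in the subfield `L` of `F`. -/
noncomputable def integersIn (L : IntermediateField ℚ_[p] F) : Subalgebra ℤ_[p] V :=
  (L.toSubalgebra.restrictScalars ℤ_[p]).comap (IsScalarTower.toAlgHom ℤ_[p] V F)

theorem exists_integersIn_algebraMap_eq_iff [IsIntegralClosure V ℤ_[p] F]
    (L : IntermediateField ℚ_[p] F) (x : F) :
    (∃ a, algebraMap (integersIn V L) F a = x) ↔ x ∈ L ∧ IsIntegral ℤ_[p] x := by
  constructor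
  · rintro ⟨a, rfl⟩
    exact ⟨a.2, IsIntegralClosure.isIntegral_iff.2 ⟨a.1, rfl⟩⟩
  · rintro ⟨hL, hx⟩
    obtain ⟨v, rfl⟩ := (IsIntegralClosure.isIntegral_iff (A := V)).1 hx
    exact ⟨⟨v, hL⟩, rfl⟩

/-- Any finite set of elements of `V` lies in a finite extension of a given one. -/
theorem exists_finiteDimensional_le (L : IntermediateField ℚ_[p] F) [FiniteDimensional ℚ_[p] L]
    [Algebra.IsAlgebraic ℚ_[p] F] (s : Finset V) :
    ∃ M : IntermediateField ℚ_[p] F, FiniteDimensional ℚ_[p] M ∧ L ≤ M ∧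
      ∀ v ∈ s, v ∈ integersIn V M := by
  classical
  have : FiniteDimensional ℚ_[p]
      (IntermediateField.adjoin ℚ_[p] (s.image (algebraMap V F) : Set F)) :=
    IntermediateField.finiteDimensional_adjoin fun x _ =>
      (Algebra.IsAlgebraic.isAlgebraic x).isIntegral
  refine ⟨L ⊔ IntermediateField.adjoin ℚ_[p] (s.image (algebraMap V F)), inferInstance,
    le_sup_left, fun v hv => ?_⟩
  exact (le_sup_right : _ ≤ L ⊔ _) (IntermediateField.subset_adjoin _ _
    (Finset.mem_coe.2 (Finset.mem_image_of_mem _ hv)))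

variable [Algebra.IsAlgebraic ℚ_[p] F] [IsIntegralClosure V ℤ_[p] F] [IsDomain V]
  [FaithfulSMul V F]

instance (L : IntermediateField ℚ_[p] F) : FaithfulSMul (integersIn V L) F := by
  rw [faithfulSMul_iff_algebraMap_injective]
  exact (FaithfulSMul.algebraMap_injective V F).comp Subtype.val_injective

instance (L : IntermediateField ℚ_[p] F) [FiniteDimensional ℚ_[p] L] :
    IsDiscreteValuationRing (integersIn V L) :=
  isDiscreteValuationRing_of_range L (exists_integersIn_algebraMap_eq_iff L)

instance (L : IntermediateField ℚ_[p] F) [FiniteDimensional ℚ_[p] L] :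
    Module.Finite ℤ_[p] (integersIn V L) :=
  finite_of_range L fun x => (exists_integersIn_algebraMap_eq_iff L x).1

theorem exists_integersIn_le_adjoin {A : Type*} [CommRing A] [Algebra ℤ_[p] A] [Algebra A V]
    [IsScalarTower ℤ_[p] A V] [IsDomain A] [IsLocalRing A] [Module.Finite ℤ_[p] A]
    [FaithfulSMul A V] (L : IntermediateField ℚ_[p] F) [FiniteDimensional ℚ_[p] L]
    (hA : ∀ a, algebraMap A V a ∈ integersIn V L) :
    ∃ y ∈ integersIn V L, ∀ z ∈ integersIn V L, z ∈ Algebra.adjoin A {y} := by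
  let : Algebra A (integersIn V L) :=
    ((algebraMap A V).codRestrict (integersIn V L).toSubring hA).toAlgebra
  have : IsScalarTower A (integersIn V L) V := IsScalarTower.of_algebraMap_eq fun _ => rfl
  have : IsScalarTower ℤ_[p] A (integersIn V L) := IsScalarTower.of_algebraMap_eq fun r =>
    Subtype.ext (IsScalarTower.algebraMap_apply ℤ_[p] A V r)
  have : FaithfulSMul A (integersIn V L) := by
    rw [faithfulSMul_iff_algebraMap_injective]
    exact fun a b hab => FaithfulSMul.algebraMap_injective A V (congr_arg Subtype.val hab)
  have : FaithfulSMul ℤ_[p] (integersIn V L) := faithfulSMul p F _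
  obtain ⟨y, hy⟩ := exists_adjoin_eq_top (p := p) (A := A) (B := integersIn V L)
  refine ⟨y, y.2, fun z hz => ?_⟩
  have h1 : (⟨z, hz⟩ : integersIn V L) ∈ Algebra.adjoin A {y} := hy ▸ Algebra.mem_top
  have h2 : z ∈ (Algebra.adjoin A {y}).map (IsScalarTower.toAlgHom A (integersIn V L) V) :=
    ⟨_, h1, rfl⟩
  rwa [AlgHom.map_adjoin_singleton] at h2

end PadicInt

end IntegralClosure

section Different

open Polynomial TrivSqZeroExt

theorem minpoly.aeval_derivative_ne_zero {A V : Type*} [CommRing A] [IsDomain A]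
    [IsIntegrallyClosed A] [CharZero A] [CommRing V] [IsDomain V] [Algebra A V] [FaithfulSMul A V]
    {y : V} (hy : IsIntegral A y) : Polynomial.aeval y (derivative (minpoly A y)) ≠ 0 := by
  intro h
  have hdvd := minpoly.isIntegrallyClosed_dvd hy h
  have h0 : derivative (minpoly A y) = 0 := by
    by_contra h0
    exact (minpoly.monic hy).not_dvd_of_degree_lt h0
      (degree_derivative_lt (minpoly.ne_zero hy)) hdvd
  exact (minpoly.natDegree_pos hy).ne' (derivative_eq_zero.1 h0)

variable {p : ℕ} [Fact p.Prime] {F : Type*} [Field F] [Algebra ℚ_[p] F] [Algebra ℤ_[p] F]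
  [IsScalarTower ℤ_[p] ℚ_[p] F] {V : Type*} [CommRing V] [Algebra ℤ_[p] V] [Algebra V F]
  [IsScalarTower ℤ_[p] V F] [Algebra.IsAlgebraic ℚ_[p] F] [IsIntegralClosure V ℤ_[p] F]
  [IsDomain V] [FaithfulSMul V F] {R : Type*} [CommRing R] [IsDomain R] [IsIntegrallyClosed R]
  [Algebra ℤ_[p] R] [Algebra R V] [IsScalarTower ℤ_[p] R V] [FaithfulSMul R V]

namespace PadicInt

theorem exists_subalgebra_derivation {N : Type*} [AddCommGroup N] [Module V N]
    (hN : ∀ c : V, c ≠ 0 → ∀ m : N, ∃ m', c • m' = m)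
    {L : IntermediateField ℚ_[p] F} [FiniteDimensional ℚ_[p] L]
    (hR : ∀ r, algebraMap R V r ∈ integersIn V L) {y : V} (hy : y ∈ integersIn V L)
    (hy' : ∀ z ∈ integersIn V L, z ∈ Algebra.adjoin R {y}) {n : N}
    (hn : aeval y (derivative (minpoly R y)) • n = 0) (s : Finset V) :
    ∃ (B : Subalgebra R V) (δ : V → N), (∀ v ∈ s, v ∈ B) ∧
      (∀ a ∈ B, ∀ b ∈ B, δ (a + b) = δ a + δ b) ∧
      (∀ a ∈ B, ∀ b ∈ B, δ (a * b) = a • δ b + b • δ a) ∧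
      (∀ r : R, δ (algebraMap R V r) = 0) ∧ δ y = n := by
  classical
  let : Module Vᵐᵒᵖ N := Module.compHom N ((RingHom.id V).fromOpposite fun _ _ => mul_comm _ _)
  have : IsCentralScalar V N := ⟨fun _ _ => rfl⟩
  have hint : ∀ v : V, IsIntegral ℤ_[p] v :=
    (IsIntegralClosure.isIntegral_algebra ℤ_[p] F).isIntegral
  let O := integersIn V L
  obtain ⟨M, hM, hLM, hsM⟩ := exists_finiteDimensional_le L s
  obtain ⟨y₂, hy₂, hy₂'⟩ := exists_integersIn_le_adjoin (V := V) (A := O) M fun a => hLM a.2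
  have : FaithfulSMul ℤ_[p] O := faithfulSMul p F O
  have : CharZero O := charZero_of_injective_algebraMap (FaithfulSMul.algebraMap_injective ℤ_[p] O)
  obtain ⟨ψ₁, hψ₁, hψ₁y, hψ₁fst⟩ := exists_lift_adjoin_singleton (hint y).tower_top
    ((inlHom V N).comp (algebraMap R V)) (fun a => rfl) (n := n) (by
      rw [hn, zero_add]
      exact congr_arg snd (hom_eval₂ (minpoly R y) (algebraMap R V) (inlHom V N) y).symm)
  let i : O →+* Algebra.adjoin R {y} := Subring.inclusion (S := O.toSubring)
    (T := (Algebra.adjoin R {y}).toSubring) hy'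
  obtain ⟨n₂, hn₂⟩ := hN _ (minpoly.aeval_derivative_ne_zero (A := O) (y := y₂)
    (hint y₂).tower_top) (-((minpoly O y₂).eval₂ (ψ₁.comp i) (inl y₂)).snd)
  obtain ⟨ψ₂, hψ₂, -, hψ₂fst⟩ := exists_lift_adjoin_singleton (A := O) (hint y₂).tower_top
    (ψ₁.comp i) (fun a => hψ₁fst _) (n := n₂) (by rw [hn₂, neg_add_cancel])
  have hO : ∀ z (hz : z ∈ O), ∃ h : z ∈ Algebra.adjoin O {y₂}, ψ₂ ⟨z, h⟩ = ψ₁ ⟨z, hy' z hz⟩ :=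
    fun z hz => ⟨(Algebra.adjoin O {y₂}).algebraMap_mem ⟨z, hz⟩, hψ₂ ⟨z, hz⟩⟩
  let δ : V → N := fun v => if h : v ∈ Algebra.adjoin O {y₂} then (ψ₂ ⟨v, h⟩).snd else 0
  have hδ : ∀ v (h : v ∈ Algebra.adjoin O {y₂}), δ v = (ψ₂ ⟨v, h⟩).snd := fun v h => dif_pos h
  refine ⟨{ (Algebra.adjoin O {y₂}).toSubring with
    algebraMap_mem' := fun r => (hO _ (hR r)).1 }, δ, fun v hv => hy₂' v (hsM v hv), ?_, ?_, ?_, ?_⟩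
  · intro a ha b hb
    rw [hδ a ha, hδ b hb, hδ _ (add_mem ha hb), ← snd_add, ← map_add]
    rfl
  · intro a ha b hb
    have : ψ₂ ⟨a * b, mul_mem ha hb⟩ = ψ₂ ⟨a, ha⟩ * ψ₂ ⟨b, hb⟩ := by
      rw [← map_mul]
      rfl
    rw [hδ a ha, hδ b hb, hδ _ (mul_mem ha hb), this, snd_mul, hψ₂fst, hψ₂fst]
    rfl
  · intro r
    obtain ⟨h, h'⟩ := hO _ (hR r)
    rw [hδ _ h, h']
    exact congr_arg snd (hψ₁ r)
  · obtain ⟨h, h'⟩ := hO _ hy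
    rw [hδ _ h, h']
    have := congr_arg snd hψ₁y
    rwa [snd_add, snd_inl, snd_inr, zero_add] at this

/-- If `R[y]` is the ring of integers of a finite extension of `ℚ_p`, the annihilator of `d y` in
`Ω[V⁄R]` is generated by the derivative at `y` of its minimal polynomial. -/
theorem smul_kaehlerDifferential_eq_zero_iff
    {L : IntermediateField ℚ_[p] F} [FiniteDimensional ℚ_[p] L]
    (hR : ∀ r, algebraMap R V r ∈ integersIn V L) {y : V} (hy : y ∈ integersIn V L)
    (hy' : ∀ z ∈ integersIn V L, z ∈ Algebra.adjoin R {y}) {a : V} :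
    a • KaehlerDifferential.D R V y = 0 ↔ aeval y (derivative (minpoly R y)) ∣ a := by
  constructor
  · intro ha
    let c := aeval y (derivative (minpoly R y))
    let P : Submodule V F := Submodule.span V {algebraMap V F c}
    have hinj := FaithfulSMul.algebraMap_injective V F
    have h1 : a • P.mkQ 1 = 0 := by
      refine KaehlerDifferential.smul_eq_zero_of_forall_finset
        (exists_subalgebra_derivation ?_ hR hy hy' (n := P.mkQ 1) ?_) ha
      · intro c hc m
        obtain ⟨m, rfl⟩ := P.mkQ_surjective m
        refine ⟨P.mkQ (m / algebraMap V F c), ?_⟩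
        rw [← map_smul, Algebra.smul_def, mul_div_cancel₀]
        exact fun h => hc (hinj (h.trans (map_zero _).symm))
      · rw [← map_smul, Algebra.smul_def, mul_one, ← LinearMap.mem_ker, P.ker_mkQ]
        exact Submodule.mem_span_singleton_self _
    rw [← map_smul, Algebra.smul_def, mul_one, ← LinearMap.mem_ker, P.ker_mkQ,
      Submodule.mem_span_singleton] at h1
    obtain ⟨b, hb⟩ := h1
    exact ⟨b, hinj (by rw [← hb, Algebra.smul_def, mul_comm, map_mul])⟩
  · rintro ⟨b, rfl⟩
    have := (KaehlerDifferential.D R V).map_aeval (minpoly R y) y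
    rw [minpoly.aeval, map_zero] at this
    rw [mul_comm, mul_smul, ← this, smul_zero]

end PadicInt

end Different

section LocallyCyclic

open Polynomial IsLocalRing

theorem KaehlerDifferential.exists_finset_mem_span {R V : Type*} [CommRing R] [CommRing V]
    [Algebra R V] (x : Ω[V⁄R]) :
    ∃ s : Finset V, x ∈ Submodule.span V (KaehlerDifferential.D R V '' s) := by
  classical
  have hx : x ∈ Submodule.span V (Set.range (KaehlerDifferential.D R V)) :=
    KaehlerDifferential.span_range_derivation R V ▸ Submodule.mem_top
  obtain ⟨t, ht, hxt⟩ := Submodule.mem_span_finite_of_mem_span hx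
  rw [← Set.image_univ, Finset.subset_set_image_iff] at ht
  obtain ⟨s, -, rfl⟩ := ht
  exact ⟨s, by rwa [Finset.coe_image] at hxt⟩

theorem KaehlerDifferential.span_image_le_of_le_adjoin {R V : Type*} [CommRing R] [CommRing V]
    [Algebra R V] {s : Set V} {y : V} (hs : ∀ z ∈ s, z ∈ Algebra.adjoin R {y}) :
    Submodule.span V (KaehlerDifferential.D R V '' s) ≤
      Submodule.span V {KaehlerDifferential.D R V y} := by
  rw [Submodule.span_le]
  rintro _ ⟨z, hz, rfl⟩
  obtain ⟨q, rfl⟩ := Algebra.adjoin_singleton_eq_range_aeval R y ▸ hs z hz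
  rw [AlgHom.toRingHom_eq_coe, RingHom.coe_coe, Derivation.map_aeval]
  exact Submodule.smul_mem _ _ (Submodule.mem_span_singleton_self _)

theorem KaehlerDifferential.exists_natCast_smul_eq {R V : Type*} [CommRing R] [CommRing V]
    [Algebra R V] {n : ℕ} (hn : ∀ v : V, ∃ w, w ^ n = v) (x : Ω[V⁄R]) : ∃ y, (n : V) • y = x := by
  have hx : x ∈ Submodule.span V (Set.range (KaehlerDifferential.D R V)) :=
    KaehlerDifferential.span_range_derivation R V ▸ Submodule.mem_top
  induction hx using Submodule.span_induction with
  | mem x h =>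
    obtain ⟨v, rfl⟩ := h
    obtain ⟨w, rfl⟩ := hn v
    exact ⟨w ^ (n - 1) • KaehlerDifferential.D R V w, by
      rw [Derivation.leibniz_pow, Nat.cast_smul_eq_nsmul]⟩
  | zero => exact ⟨0, smul_zero _⟩
  | add x y _ _ hx hy =>
    obtain ⟨x, rfl⟩ := hx
    obtain ⟨y, rfl⟩ := hy
    exact ⟨x + y, smul_add _ _ _⟩
  | smul a x _ hx =>
    obtain ⟨x, rfl⟩ := hx
    exact ⟨a • x, smul_comm _ _ _⟩

variable {p : ℕ} [Fact p.Prime] {F : Type*} [Field F] [Algebra ℚ_[p] F] [Algebra ℤ_[p] F]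
  [IsScalarTower ℤ_[p] ℚ_[p] F] {V : Type*} [CommRing V] [Algebra ℤ_[p] V] [Algebra V F]
  [IsScalarTower ℤ_[p] V F] [Algebra.IsAlgebraic ℚ_[p] F] [IsIntegralClosure V ℤ_[p] F]
  [IsDomain V] [FaithfulSMul V F] {R : Type*} [CommRing R] [IsDomain R]
  [Algebra ℤ_[p] R] [Algebra R V] [IsScalarTower ℤ_[p] R V] [FaithfulSMul R V]
  [Module.Finite ℤ_[p] R]

namespace PadicInt

theorem exists_forall_mem_adjoin [IsLocalRing R] (L : IntermediateField ℚ_[p] F)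
    [FiniteDimensional ℚ_[p] L] (hR : ∀ r, algebraMap R V r ∈ integersIn V L) (s : Finset V) :
    ∃ (M : IntermediateField ℚ_[p] F) (y : V), FiniteDimensional ℚ_[p] M ∧
      (∀ r, algebraMap R V r ∈ integersIn V M) ∧ (∀ v ∈ s, v ∈ integersIn V M) ∧
      y ∈ integersIn V M ∧ ∀ z ∈ integersIn V M, z ∈ Algebra.adjoin R {y} := by
  obtain ⟨M, hM, hLM, hsM⟩ := exists_finiteDimensional_le L s
  obtain ⟨y, hy, hy'⟩ := exists_integersIn_le_adjoin (V := V) (A := R) M fun r => hLM (hR r)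
  exact ⟨M, y, hM, fun r => hLM (hR r), hsM, hy, hy'⟩

theorem exists_kaehlerDifferential_generator_of_pair [IsDiscreteValuationRing R] [CharZero R]
    (L : IntermediateField ℚ_[p] F)
    [FiniteDimensional ℚ_[p] L] (hR : ∀ r, algebraMap R V r ∈ integersIn V L) (x₁ x₂ : Ω[V⁄R]) :
    ∃ (ω : Ω[V⁄R]) (c : V), c ≠ 0 ∧ (∀ a, a • ω = 0 ↔ c ∣ a) ∧ (∃ b : V, b • ω = x₁) ∧
      ∃ b : V, b • ω = x₂ := by
  classical
  obtain ⟨s₁, h₁⟩ := KaehlerDifferential.exists_finset_mem_span x₁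
  obtain ⟨s₂, h₂⟩ := KaehlerDifferential.exists_finset_mem_span x₂
  obtain ⟨M, y, hM, hRM, hsM, hy, hy'⟩ := exists_forall_mem_adjoin L hR (s₁ ∪ s₂)
  have hint : IsIntegral ℤ_[p] y :=
    (IsIntegralClosure.isIntegral_algebra ℤ_[p] F).isIntegral y
  refine ⟨KaehlerDifferential.D R V y, _, minpoly.aeval_derivative_ne_zero hint.tower_top,
    fun a => smul_kaehlerDifferential_eq_zero_iff hRM hy hy',
    Submodule.mem_span_singleton.1 (KaehlerDifferential.span_image_le_of_le_adjoin ?_ h₁),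
    Submodule.mem_span_singleton.1 (KaehlerDifferential.span_image_le_of_le_adjoin ?_ h₂)⟩
  · exact fun z hz => hy' z (hsM z (Finset.mem_union_left _ hz))
  · exact fun z hz => hy' z (hsM z (Finset.mem_union_right _ hz))

/-- `V` is ramified over `R` as soon as it contains a square root of a uniformizer of `R`. -/
theorem nontrivial_kaehlerDifferential [IsDiscreteValuationRing R] [CharZero R] [IsLocalRing V]
    (L : IntermediateField ℚ_[p] F)
    [FiniteDimensional ℚ_[p] L] (hR : ∀ r, algebraMap R V r ∈ integersIn V L)
    (hV : ∀ v : V, ∃ w, w ^ 2 = v) : Nontrivial Ω[V⁄R] := by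
  have hVint := IsIntegralClosure.isIntegral_algebra ℤ_[p] F (A := V)
  have : Algebra.IsIntegral R V := ⟨fun v => (hVint.isIntegral v).tower_top⟩
  by_contra hsub
  rw [not_nontrivial_iff_subsingleton] at hsub
  obtain ⟨ϖ, hϖ⟩ := IsDiscreteValuationRing.exists_irreducible R
  obtain ⟨x, hx⟩ := hV (algebraMap R V ϖ)
  obtain ⟨M, y, hM, hRM, hsM, hy, hy'⟩ := exists_forall_mem_adjoin L hR {x}
  have hunit : IsUnit (aeval y (derivative (minpoly R y))) :=
    isUnit_of_dvd_one ((smul_kaehlerDifferential_eq_zero_iff hRM hy hy').1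
      (Subsingleton.elim _ _))
  have hϖV : ¬ IsUnit (algebraMap R V ϖ) := fun h => hϖ.not_isUnit ((isUnit_map_iff _ _).1 h)
  have hϖ0 : algebraMap R V ϖ ≠ 0 := fun h =>
    hϖ.ne_zero (FaithfulSMul.algebraMap_injective R V (h.trans (map_zero _).symm))
  have hxu : ¬ IsUnit x := fun h => hϖV (hx ▸ h.pow 2)
  obtain ⟨q, rfl⟩ := Algebra.adjoin_singleton_eq_range_aeval R y ▸
    hy' x (hsM x (Finset.mem_singleton_self x))
  obtain ⟨u, hu⟩ := dvd_aeval_of_isUnit_aeval_derivative hϖ.maximalIdeal_eq (minpoly.aeval R y)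
    hunit (h := q) hxu
  rw [AlgHom.toRingHom_eq_coe, RingHom.coe_coe, hu] at hx
  refine hϖV (IsUnit.of_mul_eq_one (u ^ 2) (mul_left_cancel₀ hϖ0 ?_))
  linear_combination hx

end PadicInt

end LocallyCyclic

theorem IsIntegralClosure.exists_pow_eq {A B C : Type*} [CommRing A] [CommRing B] [Field C]
    [Algebra A C] [Algebra B C] [IsIntegralClosure B A C] [IsAlgClosed C] {n : ℕ} (hn : 0 < n)
    (v : B) : ∃ w, w ^ n = v := by
  obtain ⟨z, hz⟩ := IsAlgClosed.exists_pow_nat_eq (algebraMap B C v) hn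
  have hint : IsIntegral A z := IsIntegral.of_pow hn (hz ▸ isIntegral_iff.2 ⟨v, rfl⟩)
  obtain ⟨w, rfl⟩ := (isIntegral_iff (A := B)).1 hint
  exact ⟨w, algebraMap_injective B A C (by rw [map_pow, hz])⟩

/-- Let `K` be a finite extension of `ℚ_p` with ring of integers
`O_K` and `O_K̄` the ring of integers of an algebraic closure `K̄`.  Let `O_{C_K}`
be the `p`-adic completion of `O_K̄` (axiomatized below via `ρ : O_K̄ → O_{C_K}`),
acting on the Tate module `T_p(Ω¹_{O_K̄/O_K})` compatibly with the `O_K̄`-action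
(this pins down the canonical `O_{C_K}`-module structure, by continuity).  Then
`T_p(Ω¹_{O_K̄/O_K})` is a free `O_{C_K}`-module of rank `1`. -/
theorem tateModule_kaehler_free_rank_one
    (p : ℕ) [Fact p.Prime]
    (K : Type*) [Field K] [Algebra ℚ_[p] K] [FiniteDimensional ℚ_[p] K]
    (Kbar : Type*) [Field Kbar] [Algebra K Kbar] [IsAlgClosure K Kbar]
    [Algebra ℤ_[p] K] [IsScalarTower ℤ_[p] ℚ_[p] K]
    [Algebra ℚ_[p] Kbar] [Algebra ℤ_[p] Kbar]
    [IsScalarTower ℤ_[p] ℚ_[p] Kbar] [IsScalarTower ℚ_[p] K Kbar]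
    (OK : Type*) [CommRing OK] [Algebra ℤ_[p] OK] [Algebra OK K]
    [IsScalarTower ℤ_[p] OK K] [IsIntegralClosure OK ℤ_[p] K]
    (OKbar : Type*) [CommRing OKbar] [Algebra ℤ_[p] OKbar] [Algebra OKbar Kbar]
    [IsScalarTower ℤ_[p] OKbar Kbar] [IsIntegralClosure OKbar ℤ_[p] Kbar]
    [Algebra OK OKbar] [Algebra OK Kbar] [IsScalarTower OK K Kbar]
    [IsScalarTower OK OKbar Kbar]
    -- `O_{C_K}`, the `p`-adic completion of `O_K̄` :
    (OCK : Type*) [CommRing OCK] (ρ : OKbar →+* OCK)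
    (hρ_inj : Function.Injective ρ)
    (hρ_dense : ∀ (x : OCK) (n : ℕ), ∃ y : OKbar,
      x - ρ y ∈ Ideal.span {(p : OCK) ^ n})
    (hρ_mod : ∀ (y : OKbar) (n : ℕ), ρ y ∈ Ideal.span {(p : OCK) ^ n} →
      y ∈ Ideal.span {(p : OKbar) ^ n})
    (hcomplete : IsAdicComplete (Ideal.span {(p : OCK)}) OCK)
    -- the canonical `O_{C_K}`-module structure on the Tate module :
    [Module OCK (TateModule p OKbar (KaehlerDifferential OK OKbar))]
    (hcompat : ∀ (a : OKbar) (x : TateModule p OKbar (KaehlerDifferential OK OKbar)),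
      ρ a • x = a • x) :
    ∃ t : TateModule p OKbar (KaehlerDifferential OK OKbar),
      ∀ x : TateModule p OKbar (KaehlerDifferential OK OKbar), ∃! a : OCK, a • t = x := by
  have hinjK := IsIntegralClosure.algebraMap_injective OK ℤ_[p] K
  have hinjV := IsIntegralClosure.algebraMap_injective OKbar ℤ_[p] Kbar
  have hinjR : Function.Injective (algebraMap OK Kbar) := by
    rw [IsScalarTower.algebraMap_eq OK K Kbar]
    exact (FaithfulSMul.algebraMap_injective K Kbar).comp hinjK
  have : IsDomain OK := hinjK.isDomain (algebraMap OK K)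
  have : IsDomain OKbar := hinjV.isDomain (algebraMap OKbar Kbar)
  have : FaithfulSMul OK Kbar := (faithfulSMul_iff_algebraMap_injective _ _).2 hinjR
  have : FaithfulSMul OKbar Kbar := (faithfulSMul_iff_algebraMap_injective _ _).2 hinjV
  have : FaithfulSMul OK OKbar := by
    rw [faithfulSMul_iff_algebraMap_injective]
    refine Function.Injective.of_comp (f := algebraMap OKbar Kbar) ?_
    rwa [← RingHom.coe_comp, ← IsScalarTower.algebraMap_eq]
  have hKtower : ∀ r, algebraMap K Kbar (algebraMap ℤ_[p] K r) = algebraMap ℤ_[p] Kbar r :=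
    fun r => by
      rw [IsScalarTower.algebraMap_apply ℤ_[p] ℚ_[p] K,
        IsScalarTower.algebraMap_apply ℤ_[p] ℚ_[p] Kbar,
        ← IsScalarTower.algebraMap_apply ℚ_[p] K Kbar]
  have : IsScalarTower ℤ_[p] K Kbar := IsScalarTower.of_algebraMap_eq fun r => (hKtower r).symm
  have : IsScalarTower ℤ_[p] OK Kbar := IsScalarTower.of_algebraMap_eq fun r => by
    rw [IsScalarTower.algebraMap_apply OK K Kbar, ← IsScalarTower.algebraMap_apply ℤ_[p] OK K,
      hKtower]
  have : IsScalarTower ℤ_[p] OK OKbar := IsScalarTower.of_algebraMap_eq fun r => hinjV <| by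
    rw [← IsScalarTower.algebraMap_apply OK OKbar Kbar, ← IsScalarTower.algebraMap_apply,
      ← IsScalarTower.algebraMap_apply]
  have := IsAlgClosure.isAlgebraic (R := K) (K := Kbar)
  have := IsAlgClosure.isAlgClosed K (K := Kbar)
  have : Algebra.IsAlgebraic ℚ_[p] Kbar := Algebra.IsAlgebraic.trans ℚ_[p] K Kbar
  let L : IntermediateField ℚ_[p] Kbar := (IsScalarTower.toAlgHom ℚ_[p] K Kbar).fieldRange
  have hL : ∀ x : Kbar, (∃ a, algebraMap OK Kbar a = x) ↔ x ∈ L ∧ IsIntegral ℤ_[p] x := by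
    intro x
    constructor
    · rintro ⟨a, rfl⟩
      rw [IsScalarTower.algebraMap_apply OK K Kbar]
      exact ⟨⟨_, rfl⟩, ((IsIntegralClosure.isIntegral_iff (A := OK)).2 ⟨a, rfl⟩).algebraMap⟩
    · rintro ⟨⟨z, rfl⟩, hz⟩
      have hz' : IsIntegral ℤ_[p] z :=
        (isIntegral_algebraMap_iff (FaithfulSMul.algebraMap_injective K Kbar)).1 hz
      obtain ⟨a, rfl⟩ := (IsIntegralClosure.isIntegral_iff (A := OK)).1 hz'
      exact ⟨a, IsScalarTower.algebraMap_apply OK K Kbar a⟩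
  have : FiniteDimensional ℚ_[p] L :=
    LinearMap.finiteDimensional_range (IsScalarTower.toAlgHom ℚ_[p] K Kbar).toLinearMap
  have : IsDiscreteValuationRing OK := PadicInt.isDiscreteValuationRing_of_range L hL
  have : Module.Finite ℤ_[p] OK := PadicInt.finite_of_range L fun x => (hL x).1
  have : ValuationRing OKbar := PadicInt.valuationRing_of_range (p := p) (F := Kbar) ⊤ fun x => by
    rw [← IsIntegralClosure.isIntegral_iff (A := OKbar) (R := ℤ_[p])]
    exact ⟨fun h => ⟨IntermediateField.mem_top, h⟩, And.right⟩
  have := PadicInt.faithfulSMul p Kbar OK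
  have := PadicInt.faithfulSMul p Kbar OKbar
  have : CharZero OK :=
    charZero_of_injective_algebraMap (FaithfulSMul.algebraMap_injective ℤ_[p] OK)
  have : Algebra.IsIntegral ℤ_[p] OKbar := IsIntegralClosure.isIntegral_algebra ℤ_[p] Kbar
  have hp0 : (p : OKbar) ≠ 0 := by
    rw [← map_natCast (algebraMap ℤ_[p] OKbar), ← map_zero (algebraMap ℤ_[p] OKbar)]
    exact (FaithfulSMul.algebraMap_injective ℤ_[p] OKbar).ne PadicInt.prime_p.ne_zero
  have hR : ∀ r, algebraMap OK OKbar r ∈ PadicInt.integersIn OKbar L := fun r => by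
    change algebraMap OKbar Kbar _ ∈ L
    rw [← IsScalarTower.algebraMap_apply OK OKbar Kbar]
    exact ((hL _).1 ⟨r, rfl⟩).1
  have := PadicInt.nontrivial_kaehlerDifferential L hR
    (IsIntegralClosure.exists_pow_eq (A := ℤ_[p]) (C := Kbar) two_pos)
  have hdiv := KaehlerDifferential.exists_natCast_smul_eq (R := OK)
    (IsIntegralClosure.exists_pow_eq (A := ℤ_[p]) (B := OKbar) (C := Kbar)
      (Fact.out : p.Prime).pos)
  obtain ⟨ω, hω, hgen⟩ := exists_generator_torsion_of_divisible hp0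
    (PadicInt.not_isUnit_natCast_of_isIntegral (p := p)) hdiv
    (PadicInt.exists_kaehlerDifferential_generator_of_pair L hR)
  simp only [Nat.cast_smul_eq_nsmul] at hdiv hgen
  exact TateModule.exists_existsUnique_smul_eq hdiv hω hgen ρ
    (fun x => by simpa using hρ_dense x 1) hcompat
end

section
/- For every finite subextension K ⊆ L ⊆ K̄ with ring of integers O_L, the canonical map O_K̄ ⊗_{O_L} Ω¹_{O_L/O_K} → Ω¹_{O_K̄/O_K} is injective; in particular the natural map Ω¹_{O_L/O_K} → Ω¹_{O_K̄/O_K} is injective. -/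
open Polynomial in
/-- If `S = R[α]` is a domain and the ideal of relations of `α` is generated by a polynomial `g`
with `g'(α) ≠ 0`, then `H¹(L_{S/R})` vanishes. -/
theorem Algebra.subsingleton_h1Cotangent_of_ker_aeval_eq_span {R S : Type*} [CommRing R]
    [CommRing S] [IsDomain S] [Algebra R S] {α : S} {g : R[X]}
    (hα : Function.Surjective (aeval α : R[X] →ₐ[R] S))
    (hg : RingHom.ker (aeval α : R[X] →ₐ[R] S) = Ideal.span {g})
    (hg' : aeval α (derivative g) ≠ 0) :
    Subsingleton (Algebra.H1Cotangent R S) := by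
  let P : Algebra.Extension R S := Algebra.Extension.ofSurjective (aeval α) hα
  have : Algebra.FormallySmooth R P.Ring := inferInstanceAs (Algebra.FormallySmooth R R[X])
  rw [← Algebra.Extension.cotangentComplex_injective_iff P, injective_iff_map_eq_zero]
  intro x hx
  obtain ⟨⟨y, hy⟩, rfl⟩ := Algebra.Extension.Cotangent.mk_surjective x
  have hker : P.ker = Ideal.span {g} := hg
  have hga : aeval α g = 0 := by
    have : g ∈ RingHom.ker (aeval α : R[X] →ₐ[R] S) := hg ▸ Ideal.mem_span_singleton_self g
    exact this
  obtain ⟨h : R[X], rfl⟩ := Ideal.mem_span_singleton.mp (hker ▸ hy)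
  rw [Algebra.Extension.cotangentComplex_mk] at hx
  let e' : Ω[R[X]⁄R] →ₗ[R[X]] R[X] := (KaehlerDifferential.polynomialEquiv R).toLinearMap
  let e : Ω[P.Ring⁄R] →ₗ[P.Ring] P.Ring := e'
  let φ : Ω[P.Ring⁄R] →ₗ[P.Ring] S := (Algebra.linearMap P.Ring S).comp e
  have h1 : aeval α (derivative (g * h)) = 0 := by
    have h2 := congrArg (φ.liftBaseChange S) hx
    rw [LinearMap.liftBaseChange_tmul, map_zero, one_smul] at h2
    rw [← KaehlerDifferential.polynomialEquiv_D]
    exact h2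
  have h2 : aeval α h = 0 := by simpa [hga, hg'] using h1
  rw [Algebra.Extension.Cotangent.mk_eq_zero_iff]
  have hgm : g ∈ P.ker := hker ▸ Ideal.mem_span_singleton_self g
  have hhm : h ∈ P.ker := h2
  rw [pow_two]
  exact Ideal.mul_mem_mul hgm hhm
open Polynomial in
theorem Algebra.subsingleton_h1Cotangent_of_adjoin_eq_top {R S : Type*} [CommRing R] [IsDomain R]
    [IsIntegrallyClosed R] [CharZero R] [CommRing S] [IsDomain S] [Algebra R S]
    [FaithfulSMul R S] [Algebra.IsIntegral R S] {α : S} (hα : Algebra.adjoin R {α} = ⊤) :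
    Subsingleton (Algebra.H1Cotangent R S) := by
  have hint : IsIntegral R α := Algebra.IsIntegral.isIntegral α
  refine subsingleton_h1Cotangent_of_ker_aeval_eq_span (α := α) (g := minpoly R α) ?_ ?_ ?_
  · rw [← AlgHom.range_eq_top, ← Algebra.adjoin_singleton_eq_range_aeval, hα]
  · ext q
    rw [RingHom.mem_ker, Ideal.mem_span_singleton]
    exact minpoly.isIntegrallyClosed_dvd_iff hint q
  · rw [Ne, minpoly.isIntegrallyClosed_dvd_iff hint]
    have hd : derivative (minpoly R α) ≠ 0 := fun h ↦
      (minpoly.natDegree_pos hint).ne' (derivative_eq_zero.mp h)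
    intro h
    exact (natDegree_derivative_lt (minpoly.natDegree_pos hint).ne').not_ge
      (natDegree_le_of_dvd h hd)

open TensorProduct in
/-- Injectivity of `T ⊗ Ω[S⁄R] → Ω[T⁄R]` can be checked on a cofinal family of subalgebras. -/
theorem KaehlerDifferential.mapBaseChange_injective_of_subalgebras {R S T : Type*} [CommRing R]
    [CommRing S] [CommRing T] [Algebra R S] [Algebra S T] [Algebra R T] [IsScalarTower R S T]
    (H : ∀ F : Finset T, ∃ A : Subalgebra S T, (F : Set T) ⊆ A ∧
      Function.Injective (KaehlerDifferential.mapBaseChange R S A)) :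
    Function.Injective (KaehlerDifferential.mapBaseChange R S T) := by
  classical
  let m (A : Subalgebra S T) : (A →₀ A) →+ (T →₀ T) :=
    (Finsupp.mapDomain.addMonoidHom A.val).comp
      (Finsupp.mapRange.addMonoidHom A.val.toRingHom.toAddMonoidHom)
  have m_single (A : Subalgebra S T) (x y : A) :
      m A (Finsupp.single x y) = Finsupp.single (x : T) (y : T) := by simp [m]
  have m_smul (A : Subalgebra S T) (a : A) (v : A →₀ A) : m A (a • v) = (a : T) • m A v := by
    induction v using Finsupp.induction_linear with
    | zero => simp
    | add f g hf hg => simp only [smul_add, map_add, hf, hg]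
    | single x y => rw [Finsupp.smul_single, m_single, m_single, Finsupp.smul_single]; rfl
  have m_inj (A : Subalgebra S T) : Function.Injective (m A) :=
    (Finsupp.mapDomain_injective Subtype.val_injective).comp
      (Finsupp.mapRange_injective _ (map_zero _) Subtype.val_injective)
  have lift_ker : ∀ v ∈ KaehlerDifferential.kerTotal R T, ∃ F : Finset T, ∀ A : Subalgebra S T,
      (F : Set T) ⊆ A → ∃ v' ∈ KaehlerDifferential.kerTotal R A, m A v' = v := by
    intro v hv
    unfold KaehlerDifferential.kerTotal at hv
    induction hv using Submodule.span_induction with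
    | zero => exact ⟨∅, fun A _ ↦ ⟨0, zero_mem _, map_zero _⟩⟩
    | add x y _ _ hx hy =>
      obtain ⟨F, hF⟩ := hx
      obtain ⟨G, hG⟩ := hy
      refine ⟨F ∪ G, fun A hA ↦ ?_⟩
      rw [Finset.coe_union, Set.union_subset_iff] at hA
      obtain ⟨v, hv, rfl⟩ := hF A hA.1
      obtain ⟨w, hw, rfl⟩ := hG A hA.2
      exact ⟨v + w, add_mem hv hw, map_add _ _ _⟩
    | smul t x _ hx =>
      obtain ⟨F, hF⟩ := hx
      refine ⟨insert t F, fun A hA ↦ ?_⟩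
      rw [Finset.coe_insert, Set.insert_subset_iff] at hA
      obtain ⟨v, hv, rfl⟩ := hF A hA.2
      exact ⟨(⟨t, hA.1⟩ : A) • v, Submodule.smul_mem _ _ hv, m_smul _ _ _⟩
    | mem x hx =>
      obtain ((⟨⟨x, y⟩, rfl⟩ | ⟨⟨x, y⟩, rfl⟩) | ⟨x, rfl⟩) := hx
      · refine ⟨{x, y}, fun A hA ↦ ?_⟩
        have hx : x ∈ A := hA (by simp)
        have hy : y ∈ A := hA (by simp)
        exact ⟨_, Submodule.subset_span (Or.inl (Or.inl ⟨(⟨x, hx⟩, ⟨y, hy⟩), rfl⟩)),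
          by simp [m_single]⟩
      · refine ⟨{x, y}, fun A hA ↦ ?_⟩
        have hx : x ∈ A := hA (by simp)
        have hy : y ∈ A := hA (by simp)
        exact ⟨_, Submodule.subset_span (Or.inl (Or.inr ⟨(⟨x, hx⟩, ⟨y, hy⟩), rfl⟩)),
          by simp [m_single]⟩
      · exact ⟨∅, fun A _ ↦ ⟨_, Submodule.subset_span (Or.inr ⟨x, rfl⟩), by
          simp only [m_single]; rfl⟩⟩
  rw [injective_iff_map_eq_zero]
  intro z hz
  have hspan : Submodule.span T
      (Set.range fun s : S ↦ (1 : T) ⊗ₜ[S] KaehlerDifferential.D R S s) = ⊤ := by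
    have := congrArg (Submodule.baseChange T) (KaehlerDifferential.span_range_derivation R S)
    rwa [Submodule.baseChange_span, Submodule.baseChange_top, ← Set.range_comp] at this
  obtain ⟨c, rfl⟩ : z ∈ LinearMap.range (Finsupp.linearCombination T
      fun s : S ↦ (1 : T) ⊗ₜ[S] KaehlerDifferential.D R S s) := by
    rw [Finsupp.range_linearCombination, hspan]; trivial
  have hc : Finsupp.mapDomain (algebraMap S T) c ∈ KaehlerDifferential.kerTotal R T := by
    rw [← KaehlerDifferential.kerTotal_eq, LinearMap.mem_ker, Finsupp.linearCombination_mapDomain,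
      ← hz, Finsupp.apply_linearCombination]
    congr 2
    ext s
    simp
  obtain ⟨F, hF⟩ := lift_ker _ hc
  obtain ⟨A, hA, hinj⟩ := H (F ∪ c.support.image c)
  rw [Finset.coe_union, Set.union_subset_iff] at hA
  obtain ⟨v, hv, hmv⟩ := hF A hA.1
  have hmem (s : S) : c s ∈ A := by
    by_cases hs : c s = 0
    · rw [hs]; exact zero_mem A
    · exact hA.2 (by simpa using ⟨s, hs, rfl⟩)
  let c' : S →₀ A := Finsupp.onFinset c.support (fun s ↦ ⟨c s, hmem s⟩) fun s hs ↦ by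
    simpa [Subtype.ext_iff] using hs
  have hc' : Finsupp.mapRange A.val (map_zero _) c' = c := by ext s; rfl
  have hv' : v = Finsupp.mapDomain (algebraMap S A) c' := by
    apply m_inj A
    rw [hmv, ← hc']
    generalize c' = d
    induction d using Finsupp.induction_linear with
    | zero => simp
    | add f g hf hg =>
      rw [Finsupp.mapRange_add (map_add A.val), Finsupp.mapDomain_add, hf, hg,
        Finsupp.mapDomain_add, map_add]
    | single x y =>
      rw [Finsupp.mapRange_single, Finsupp.mapDomain_single, Finsupp.mapDomain_single, m_single]
      rfl
  have hzA : Finsupp.linearCombination A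
      (fun s : S ↦ (1 : A) ⊗ₜ[S] KaehlerDifferential.D R S s) c' = 0 := by
    apply hinj
    rw [hv', ← KaehlerDifferential.kerTotal_eq, LinearMap.mem_ker,
      Finsupp.linearCombination_mapDomain] at hv
    rw [map_zero, ← hv, Finsupp.apply_linearCombination]
    congr 2
    ext s
    simp
  have key (d : S →₀ A) : (A.val.toLinearMap.rTensor Ω[S⁄R]) (Finsupp.linearCombination A
      (fun s : S ↦ (1 : A) ⊗ₜ[S] KaehlerDifferential.D R S s) d) =
      Finsupp.linearCombination T (fun s : S ↦ (1 : T) ⊗ₜ[S] KaehlerDifferential.D R S s)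
        (Finsupp.mapRange A.val (map_zero _) d) := by
    induction d using Finsupp.induction_linear with
    | zero => simp
    | add f g hf hg => rw [map_add, map_add, hf, hg, Finsupp.mapRange_add (map_add A.val), map_add]
    | single x y => simp [TensorProduct.smul_tmul']
  rw [← hc', ← key, hzA, map_zero]

/-- A finite local extension of a local ring that is not a field, by a discrete valuation ring with
finite residue field, is generated by one element. -/
theorem IsDiscreteValuationRing.exists_adjoin_singleton_eq_top {R S : Type*} [CommRing R]
    [IsLocalRing R] [CommRing S] [IsDomain S] [IsDiscreteValuationRing S] [Algebra R S]
    [FaithfulSMul R S] [Module.Finite R S] [Finite (IsLocalRing.ResidueField S)]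
    (hR : ¬ IsField R) : ∃ α : S, Algebra.adjoin R {α} = ⊤ := by
  classical
  let k := IsLocalRing.ResidueField S
  have : Fintype k := Fintype.ofFinite k
  obtain ⟨π, hπ⟩ := IsDiscreteValuationRing.exists_irreducible S
  have hm := hπ.maximalIdeal_eq
  have mem_iff (x : S) : IsLocalRing.residue S x = 0 ↔ π ∣ x := by
    rw [IsLocalRing.residue_eq_zero_iff, hm, Ideal.mem_span_singleton]
  obtain ⟨u, hu⟩ := IsCyclic.exists_generator (α := kˣ)
  obtain ⟨β, hβ⟩ := IsLocalRing.residue_surjective (u : k)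
  set q := Fintype.card k
  have key : ∃ α : S, IsLocalRing.residue S α = u ∧ ¬ π ^ 2 ∣ α ^ q - α := by
    by_cases h : π ^ 2 ∣ β ^ q - β
    · refine ⟨β + π, by rw [map_add, hβ, (mem_iff π).2 dvd_rfl, add_zero], fun h' ↦ ?_⟩
      have hqπ : π ∣ (q : S) := by
        rw [← mem_iff, map_natCast]
        exact FiniteField.cast_card_eq_zero k
      have h1 : π ^ 2 ∣ (β + π) ^ q - β ^ q := by
        obtain ⟨c, hc⟩ := Polynomial.binomExpansion (Polynomial.X ^ q : Polynomial S) β π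
        simp only [Polynomial.eval_pow, Polynomial.eval_X, Polynomial.derivative_X_pow,
          Polynomial.eval_mul, Polynomial.eval_C] at hc
        obtain ⟨d, hd⟩ := hqπ
        refine ⟨d * β ^ (q - 1) + c, ?_⟩
        rw [hc, hd]
        ring
      have h2 : π ^ 2 ∣ π := by
        have := dvd_sub (dvd_add h1 h) h'
        ring_nf at this
        rwa [pow_two] at this ⊢
      rw [pow_two] at h2
      nth_rewrite 3 [← mul_one π] at h2
      exact hπ.not_isUnit (isUnit_iff_dvd_one.2 ((mul_dvd_mul_iff_left hπ.ne_zero).1 h2))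
    · exact ⟨β, hβ, h⟩
  obtain ⟨α, hα, hα2⟩ := key
  refine ⟨α, ?_⟩
  set A := Algebra.adjoin R {α}
  have hαA : α ∈ A := Algebra.self_mem_adjoin_singleton R α
  set ϖ := α ^ q - α
  have hϖA : ϖ ∈ A := sub_mem (pow_mem hαA _) hαA
  have hassoc : Associated π ϖ := by
    obtain ⟨c, hc⟩ : π ∣ ϖ := by
      rw [← mem_iff, map_sub, map_pow, hα, FiniteField.pow_card, sub_self]
    have hcu : IsUnit c := by
      by_contra hcu
      have hcm : c ∈ IsLocalRing.maximalIdeal S := hcu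
      rw [hm, Ideal.mem_span_singleton] at hcm
      obtain ⟨d, rfl⟩ := hcm
      exact hα2 ⟨d, by rw [hc]; ring⟩
    exact ⟨hcu.unit, hc.symm⟩
  have step (s : S) : ∃ a ∈ A, ϖ ∣ s - a := by
    by_cases hs : IsLocalRing.residue S s = 0
    · exact ⟨0, zero_mem A, by rw [sub_zero]; exact hassoc.symm.dvd.trans ((mem_iff s).1 hs)⟩
    · obtain ⟨n, hn⟩ := (mem_powers_iff_mem_zpowers.2 (hu (Units.mk0 _ hs)))
      refine ⟨α ^ n, pow_mem hαA n, hassoc.symm.dvd.trans ?_⟩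
      have := congrArg Units.val hn
      rw [← mem_iff, map_sub, map_pow, hα, sub_eq_zero]
      simpa using this.symm
  have step_pow (n : ℕ) (s : S) : ∃ a ∈ A, ϖ ^ n ∣ s - a := by
    induction n with
    | zero => exact ⟨0, zero_mem A, by simp⟩
    | succ n ih =>
      obtain ⟨a, ha, c, hc⟩ := ih
      obtain ⟨b, hb, d, hd⟩ := step c
      refine ⟨a + ϖ ^ n * b, add_mem ha (mul_mem (pow_mem hϖA n) hb), d, ?_⟩
      linear_combination hc + ϖ ^ n * hd
  obtain ⟨r, hr, hr0⟩ : ∃ r ∈ IsLocalRing.maximalIdeal R, r ≠ 0 :=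
    Submodule.exists_mem_ne_zero_of_ne_bot fun h ↦ hR (IsLocalRing.isField_iff_maximalIdeal_eq.2 h)
  have hr0' : algebraMap R S r ≠ 0 := by
    rwa [Ne, FaithfulSMul.algebraMap_eq_zero_iff]
  obtain ⟨n, hn⟩ : ∃ n : ℕ, algebraMap R S r ∣ ϖ ^ n := by
    obtain ⟨n, hn⟩ := IsDiscreteValuationRing.associated_pow_irreducible hr0' hπ
    exact ⟨n, (hn.trans hassoc.pow_pow).dvd⟩
  have htop : (⊤ : Submodule R S) ≤ Subalgebra.toSubmodule A := by
    refine Submodule.le_of_le_smul_of_le_jacobson_bot Module.Finite.fg_top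
      (IsLocalRing.maximalIdeal_le_jacobson _) fun s _ ↦ ?_
    obtain ⟨a, ha, hs⟩ := step_pow n s
    obtain ⟨c, hc⟩ := hn.trans hs
    rw [show s = a + r • c by rw [Algebra.smul_def, ← hc]; ring]
    exact Submodule.add_mem_sup ha (Submodule.smul_mem_smul hr trivial)
  exact eq_top_iff.2 fun s _ ↦ htop (x := s) trivial

theorem Padic.isIntegral_of_spectralNorm_le_one (p : ℕ) [Fact p.Prime] {E : Type*} [Field E]
    [Algebra ℚ_[p] E] [Algebra.IsAlgebraic ℚ_[p] E] [Algebra ℤ_[p] E] [IsScalarTower ℤ_[p] ℚ_[p] E]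
    {x : E} (hx : spectralNorm ℚ_[p] E x ≤ 1) : IsIntegral ℤ_[p] x := by
  have hint : IsIntegral ℚ_[p] x := Algebra.IsIntegral.isIntegral x
  have hmonic := minpoly.monic hint
  have hcoeff := (spectralValue_le_one_iff hmonic).1 hx
  have hlift : minpoly ℚ_[p] x ∈ Polynomial.lifts (algebraMap ℤ_[p] ℚ_[p]) :=
    (Polynomial.lifts_iff_coeff_lifts _).2 fun n ↦ ⟨⟨_, hcoeff n⟩, rfl⟩
  obtain ⟨g, hg, -, hg1⟩ := Polynomial.lifts_and_natDegree_eq_and_monic hlift hmonic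
  refine ⟨g, hg1, ?_⟩
  rw [← Polynomial.aeval_def, ← Polynomial.aeval_map_algebraMap ℚ_[p], hg, minpoly.aeval]

theorem Padic.isLocalRing_of_isIntegralClosure (p : ℕ) [Fact p.Prime] (E : Type*) [Field E]
    [Algebra ℚ_[p] E] [Algebra.IsAlgebraic ℚ_[p] E] [Algebra ℤ_[p] E] [IsScalarTower ℤ_[p] ℚ_[p] E]
    (B : Type*) [CommRing B] [Algebra B E] [IsIntegralClosure B ℤ_[p] E] : IsLocalRing B := by
  have inj : Function.Injective (algebraMap B E) := IsIntegralClosure.algebraMap_injective B ℤ_[p] E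
  have : Nontrivial B := (algebraMap B E).domain_nontrivial
  have isUnit_of_one_le (b : B) (hb : 1 ≤ spectralNorm ℚ_[p] E (algebraMap B E b)) : IsUnit b := by
    have h0 : algebraMap B E b ≠ 0 := by
      intro h
      rw [h, spectralNorm_zero] at hb
      exact absurd hb (by norm_num)
    have hmul : spectralNorm ℚ_[p] E (algebraMap B E b) *
        spectralNorm ℚ_[p] E (algebraMap B E b)⁻¹ = 1 := by
      rw [← spectralMulAlgNorm_def, ← spectralMulAlgNorm_def, ← map_mul, mul_inv_cancel₀ h0,
        map_one]
    have hle : spectralNorm ℚ_[p] E (algebraMap B E b)⁻¹ ≤ 1 := by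
      nlinarith [spectralNorm_nonneg (K := ℚ_[p]) (algebraMap B E b)⁻¹]
    obtain ⟨c, hc⟩ := (IsIntegralClosure.isIntegral_iff (A := B)).1
      (isIntegral_of_spectralNorm_le_one p hle)
    exact IsUnit.of_mul_eq_one c (inj (by rw [map_mul, hc, mul_inv_cancel₀ h0, map_one]))
  refine IsLocalRing.of_isUnit_or_isUnit_one_sub_self fun b ↦ ?_
  have hna := isNonarchimedean_spectralNorm (K := ℚ_[p]) (L := E) (algebraMap B E b)
    (algebraMap B E (1 - b))
  rw [← map_add, add_sub_cancel, map_one, spectralNorm_one, le_max_iff] at hna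
  exact hna.imp (isUnit_of_one_le b) (isUnit_of_one_le (1 - b))

theorem Padic.faithfulSMul_of_isScalarTower (p : ℕ) [Fact p.Prime] (E : Type*) [Field E]
    [Algebra ℚ_[p] E] [Algebra ℤ_[p] E] [IsScalarTower ℤ_[p] ℚ_[p] E] (B : Type*) [CommRing B]
    [Algebra ℤ_[p] B] [Algebra B E] [IsScalarTower ℤ_[p] B E] : FaithfulSMul ℤ_[p] B := by
  rw [faithfulSMul_iff_algebraMap_injective]
  refine Function.Injective.of_comp (f := algebraMap B E) ?_
  rw [← RingHom.coe_comp, ← IsScalarTower.algebraMap_eq, IsScalarTower.algebraMap_eq ℤ_[p] ℚ_[p] E]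
  exact (algebraMap ℚ_[p] E).injective.comp (IsFractionRing.injective ℤ_[p] ℚ_[p])

theorem Padic.isDiscreteValuationRing_of_isIntegralClosure (p : ℕ) [Fact p.Prime] (E : Type*)
    [Field E] [Algebra ℚ_[p] E] [FiniteDimensional ℚ_[p] E] [Algebra ℤ_[p] E]
    [IsScalarTower ℤ_[p] ℚ_[p] E] (B : Type*) [CommRing B] [IsDomain B] [Algebra ℤ_[p] B]
    [Algebra B E] [IsScalarTower ℤ_[p] B E] [IsIntegralClosure B ℤ_[p] E] :
    IsDiscreteValuationRing B := by
  have : IsLocalRing B := isLocalRing_of_isIntegralClosure p E B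
  have : IsDedekindDomain B := IsIntegralClosure.isDedekindDomain ℤ_[p] ℚ_[p] E B
  have : Algebra.IsIntegral ℤ_[p] B := IsIntegralClosure.isIntegral_algebra ℤ_[p] E
  have : FaithfulSMul ℤ_[p] B := faithfulSMul_of_isScalarTower p E B
  have hB : ¬ IsField B := fun h ↦ IsDiscreteValuationRing.not_isField ℤ_[p]
    (isField_of_isIntegral_of_isField (FaithfulSMul.algebraMap_injective ℤ_[p] B) h)
  exact ((IsDiscreteValuationRing.TFAE B hB).out 0 2 rfl rfl).2 inferInstance

theorem Padic.finite_residueField_of_isIntegralClosure (p : ℕ) [Fact p.Prime] (E : Type*)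
    [Field E] [Algebra ℚ_[p] E] [FiniteDimensional ℚ_[p] E] [Algebra ℤ_[p] E]
    [IsScalarTower ℤ_[p] ℚ_[p] E] (B : Type*) [CommRing B] [IsLocalRing B] [Algebra ℤ_[p] B]
    [Algebra B E] [IsScalarTower ℤ_[p] B E] [IsIntegralClosure B ℤ_[p] E] :
    Finite (IsLocalRing.ResidueField B) := by
  have : Module.Finite ℤ_[p] B := IsIntegralClosure.finite ℤ_[p] ℚ_[p] E B
  have : FaithfulSMul ℤ_[p] B := faithfulSMul_of_isScalarTower p E B
  have : Algebra.IsIntegral ℤ_[p] B := IsIntegralClosure.isIntegral_algebra ℤ_[p] E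
  exact IsLocalRing.ResidueField.finite_of_finite (R := ℤ_[p]) inferInstance

/-- For rings of integers `B ⊆ C` of finite extensions of `ℚ_p`, `H¹(L_{C/B})` vanishes. -/
theorem Padic.subsingleton_h1Cotangent_of_isIntegralClosure (p : ℕ) [Fact p.Prime]
    (E F : Type*) [Field E] [Field F] [Algebra ℚ_[p] E] [FiniteDimensional ℚ_[p] E]
    [Algebra ℚ_[p] F] [FiniteDimensional ℚ_[p] F]
    [Algebra ℤ_[p] E] [IsScalarTower ℤ_[p] ℚ_[p] E] [Algebra ℤ_[p] F] [IsScalarTower ℤ_[p] ℚ_[p] F]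
    (B C : Type*) [CommRing B] [IsDomain B] [CommRing C] [IsDomain C]
    [Algebra ℤ_[p] B] [Algebra B E] [IsScalarTower ℤ_[p] B E] [IsIntegralClosure B ℤ_[p] E]
    [Algebra ℤ_[p] C] [Algebra C F] [IsScalarTower ℤ_[p] C F] [IsIntegralClosure C ℤ_[p] F]
    [Algebra B C] [FaithfulSMul B C] [IsScalarTower ℤ_[p] B C] :
    Subsingleton (Algebra.H1Cotangent B C) := by
  have : IsDiscreteValuationRing B := isDiscreteValuationRing_of_isIntegralClosure p E B
  have : IsDiscreteValuationRing C := isDiscreteValuationRing_of_isIntegralClosure p F C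
  have : Finite (IsLocalRing.ResidueField C) := finite_residueField_of_isIntegralClosure p F C
  have : Module.Finite ℤ_[p] C := IsIntegralClosure.finite ℤ_[p] ℚ_[p] F C
  have : Module.Finite B C := Module.Finite.of_restrictScalars_finite ℤ_[p] B C
  have : FaithfulSMul ℤ_[p] B := faithfulSMul_of_isScalarTower p E B
  have : CharZero B := charZero_of_injective_algebraMap (FaithfulSMul.algebraMap_injective ℤ_[p] B)
  obtain ⟨α, hα⟩ := IsDiscreteValuationRing.exists_adjoin_singleton_eq_top (S := C)
    (IsDiscreteValuationRing.not_isField B)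
  exact Algebra.subsingleton_h1Cotangent_of_adjoin_eq_top hα


/-- Let `K` be a finite extension of `ℚ_p` with ring of integers
`O_K`, `K̄` an algebraic closure of `K` with ring of integers `O_K̄`, and
`K ⊆ L ⊆ K̄` a finite subextension with ring of integers `O_L`.  Then the canonical
map `O_K̄ ⊗_{O_L} Ω¹_{O_L/O_K} → Ω¹_{O_K̄/O_K}` is injective; in particular the
natural map `Ω¹_{O_L/O_K} → Ω¹_{O_K̄/O_K}` is injective. -/
theorem kaehler_mapBaseChange_injective_of_finite_subextension
    (p : ℕ) [Fact p.Prime]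
    (K : Type*) [Field K] [Algebra ℚ_[p] K] [FiniteDimensional ℚ_[p] K]
    (Kbar : Type*) [Field Kbar] [Algebra K Kbar] [IsAlgClosure K Kbar]
    [Algebra ℤ_[p] K] [IsScalarTower ℤ_[p] ℚ_[p] K]
    [Algebra ℚ_[p] Kbar] [Algebra ℤ_[p] Kbar]
    [IsScalarTower ℤ_[p] ℚ_[p] Kbar] [IsScalarTower ℚ_[p] K Kbar]
    (L : Type*) [Field L] [Algebra K L] [FiniteDimensional K L]
    [Algebra ℤ_[p] L] [Algebra ℚ_[p] L] [IsScalarTower ℤ_[p] ℚ_[p] L]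
    [IsScalarTower ℚ_[p] K L]
    [Algebra L Kbar] [IsScalarTower K L Kbar]
    (OK : Type*) [CommRing OK] [Algebra ℤ_[p] OK] [Algebra OK K]
    [IsScalarTower ℤ_[p] OK K] [IsIntegralClosure OK ℤ_[p] K]
    (OL : Type*) [CommRing OL] [Algebra ℤ_[p] OL] [Algebra OL L]
    [IsScalarTower ℤ_[p] OL L] [IsIntegralClosure OL ℤ_[p] L]
    (OKbar : Type*) [CommRing OKbar] [Algebra ℤ_[p] OKbar] [Algebra OKbar Kbar]
    [IsScalarTower ℤ_[p] OKbar Kbar] [IsIntegralClosure OKbar ℤ_[p] Kbar]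
    [Algebra OK OL] [Algebra OK L] [IsScalarTower OK K L] [IsScalarTower OK OL L]
    [Algebra OL OKbar] [Algebra OL Kbar] [IsScalarTower OL L Kbar]
    [IsScalarTower OL OKbar Kbar]
    [Algebra OK OKbar] [Algebra OK Kbar] [IsScalarTower OK K Kbar]
    [IsScalarTower OK OKbar Kbar] [IsScalarTower OK OL OKbar] :
    Function.Injective (KaehlerDifferential.mapBaseChange OK OL OKbar) ∧
    Function.Injective (KaehlerDifferential.map OK OK OL OKbar) := by
  have : IsScalarTower ℤ_[p] L Kbar := .of_algebraMap_eq fun z ↦ by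
    rw [IsScalarTower.algebraMap_apply ℤ_[p] ℚ_[p] Kbar,
      IsScalarTower.algebraMap_apply ℤ_[p] ℚ_[p] L, IsScalarTower.algebraMap_apply ℚ_[p] K Kbar,
      IsScalarTower.algebraMap_apply ℚ_[p] K L, IsScalarTower.algebraMap_apply K L Kbar]
  have : IsScalarTower ℚ_[p] L Kbar := .of_algebraMap_eq fun z ↦ by
    rw [IsScalarTower.algebraMap_apply ℚ_[p] K Kbar,
      IsScalarTower.algebraMap_apply ℚ_[p] K L, IsScalarTower.algebraMap_apply K L Kbar]
  have injL : Function.Injective (algebraMap OL L) :=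
    IsIntegralClosure.algebraMap_injective OL ℤ_[p] L
  have injKbar : Function.Injective (algebraMap OKbar Kbar) :=
    IsIntegralClosure.algebraMap_injective OKbar ℤ_[p] Kbar
  have : IsScalarTower ℤ_[p] OL OKbar := .of_algebraMap_eq fun z ↦ injKbar <| by
    rw [← IsScalarTower.algebraMap_apply ℤ_[p] OKbar Kbar,
      ← IsScalarTower.algebraMap_apply OL OKbar Kbar, IsScalarTower.algebraMap_apply OL L Kbar,
      ← IsScalarTower.algebraMap_apply ℤ_[p] OL L, ← IsScalarTower.algebraMap_apply ℤ_[p] L Kbar]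
  have injOL : Function.Injective (algebraMap OL OKbar) := by
    refine Function.Injective.of_comp (f := algebraMap OKbar Kbar) ?_
    rw [← RingHom.coe_comp, ← IsScalarTower.algebraMap_eq, IsScalarTower.algebraMap_eq OL L Kbar]
    exact (algebraMap L Kbar).injective.comp injL
  have : FaithfulSMul OL OKbar := (faithfulSMul_iff_algebraMap_injective _ _).2 injOL
  have : IsDomain OL := injL.isDomain _
  have : IsDomain OKbar := injKbar.isDomain _
  have : FiniteDimensional ℚ_[p] L := FiniteDimensional.trans ℚ_[p] K L
  have : Algebra.IsAlgebraic K Kbar := IsAlgClosure.isAlgebraic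
  have : Algebra.IsAlgebraic L Kbar := Algebra.IsAlgebraic.tower_top (K := K) L
  have hbase : Function.Injective (KaehlerDifferential.mapBaseChange OK OL OKbar) := by
    refine KaehlerDifferential.mapBaseChange_injective_of_subalgebras fun F ↦ ?_
    let M : IntermediateField L Kbar :=
      IntermediateField.adjoin L (algebraMap OKbar Kbar '' (F : Set OKbar))
    have : FiniteDimensional L M := IntermediateField.finiteDimensional_adjoin
      fun x _ ↦ Algebra.IsIntegral.isIntegral x
    have : FiniteDimensional ℚ_[p] M := FiniteDimensional.trans ℚ_[p] L M
    have : IsScalarTower ℤ_[p] M Kbar := .of_algebraMap_eq fun _ ↦ rfl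
    have : IsScalarTower ℤ_[p] ℚ_[p] M := .of_algebraMap_eq fun z ↦ Subtype.ext <|
      IsScalarTower.algebraMap_apply ℤ_[p] ℚ_[p] Kbar z
    let A : Subalgebra OL OKbar :=
      (M.toSubalgebra.restrictScalars OL).comap (IsScalarTower.toAlgHom OL OKbar Kbar)
    let f : A →+* M := ((algebraMap OKbar Kbar).comp A.val.toRingHom).codRestrict M fun a ↦ a.2
    let : Algebra A M := f.toAlgebra
    have hf (a : A) : ((algebraMap A M a : M) : Kbar) = algebraMap OKbar Kbar a := rfl
    have : IsScalarTower ℤ_[p] A M := .of_algebraMap_eq fun z ↦ Subtype.ext <| by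
      rw [hf]
      exact IsScalarTower.algebraMap_apply ℤ_[p] OKbar Kbar z
    have : IsIntegralClosure A ℤ_[p] M :=
      { algebraMap_injective := fun a b h ↦ Subtype.ext (injKbar (congrArg Subtype.val h))
        isIntegral_iff := fun {x} ↦ by
          rw [← isIntegral_algebraMap_iff (algebraMap M Kbar).injective,
            IsIntegralClosure.isIntegral_iff (A := OKbar)]
          constructor
          · rintro ⟨y, hy⟩
            exact ⟨⟨y, show algebraMap OKbar Kbar y ∈ M from hy ▸ x.2⟩, Subtype.ext hy⟩
          · rintro ⟨y, rfl⟩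
            exact ⟨y, rfl⟩ }
    have := Padic.subsingleton_h1Cotangent_of_isIntegralClosure p L M OL A
    refine ⟨A, fun x hx ↦ IntermediateField.subset_adjoin L _ ⟨x, hx, rfl⟩, ?_⟩
    rw [injective_iff_map_eq_zero]
    intro x hx
    obtain ⟨y, rfl⟩ := (Algebra.H1Cotangent.exact_δ_mapBaseChange OK OL A x).1 hx
    rw [Subsingleton.elim y 0, map_zero]
  refine ⟨hbase, ?_⟩
  have : IsDiscreteValuationRing OL := Padic.isDiscreteValuationRing_of_isIntegralClosure p L OL
  have : Algebra.IsIntegral ℤ_[p] OKbar := IsIntegralClosure.isIntegral_algebra ℤ_[p] Kbar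
  have : Algebra.IsIntegral OL OKbar := Algebra.IsIntegral.tower_top ℤ_[p]
  have hcomp := hbase.comp
    (Module.FaithfullyFlat.tensorProduct_mk_injective (A := OL) (B := OKbar) Ω[OL⁄OK])
  convert hcomp using 1
  ext x
  simp
end
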